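/- Let Ω ⊆ ℝⁿ, n ≥ 3, be open and bounded, and let 1 ≤ q < n/(n−2). Then for every u ∈ W^{2,1}_{Δ,0}(Ω) one has ‖u‖_{L^q(Ω)} ≤ 2^{−2/(qn)} c_n (ω_{n-1}/n)^{(n−2)/n} [Γ(n/(n−2) − q) Γ(q+1) / Γ(n/(n−2))]^{1/q} |Ω|^{1/q − (n−2)/n} ‖Δu‖_{L¹(Ω)}. -/

import Mathlib

open MeasureTheory Filter Topology
open scoped ENNReal

noncomputable section

/-- Euclidean space ℝⁿ. -/
abbrev Euc (n : ℕ) := EuclideanSpace ℝ (Fin n)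

/-- The (pointwise) Laplacian of a function on ℝⁿ: the trace of the second derivative. -/
def lapl (n : ℕ) (φ : Euc n → ℝ) (x : Euc n) : ℝ :=
  ∑ i : Fin n,
    iteratedFDeriv ℝ 2 φ x ![EuclideanSpace.single i (1 : ℝ), EuclideanSpace.single i (1 : ℝ)]

/-- A test function on Ω: smooth and compactly supported inside Ω. -/
def IsTestFun (n : ℕ) (Ω : Set (Euc n)) (φ : Euc n → ℝ) : Prop :=
  ContDiff ℝ (⊤ : ℕ∞) φ ∧ HasCompactSupport φ ∧ tsupport φ ⊆ Ω

/-- `u ∈ W₀^{1,1}(Ω)`: `u` is an L¹(Ω) limit of test functions whose gradients converge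
in L¹(Ω) (i.e. `u` is in the closure of C_c^∞(Ω) in the W^{1,1} norm). -/
def MemW0_1_1 (n : ℕ) (Ω : Set (Euc n)) (u : Euc n → ℝ) : Prop :=
  IntegrableOn u Ω volume ∧
  ∃ φ : ℕ → Euc n → ℝ, (∀ k, IsTestFun n Ω (φ k)) ∧
    Tendsto (fun k => ∫ x in Ω, |φ k x - u x|) atTop (𝓝 0) ∧
    ∃ g : Euc n → Euc n →L[ℝ] ℝ,
      IntegrableOn (fun x => ‖g x‖) Ω volume ∧
      Tendsto (fun k => ∫ x in Ω, ‖fderiv ℝ (φ k) x - g x‖) atTop (𝓝 0)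

/-- `u ∈ W^{2,1}_Δ(Ω)` with distributional Laplacian `f ∈ L¹(Ω)`. -/
def MemW21Delta (n : ℕ) (Ω : Set (Euc n)) (u f : Euc n → ℝ) : Prop :=
  MemW0_1_1 n Ω u ∧ IntegrableOn f Ω volume ∧
    ∀ ψ : Euc n → ℝ, IsTestFun n Ω ψ →
      ∫ x in Ω, u x * lapl n ψ x = ∫ x in Ω, f x * ψ x

/-- `u ∈ W^{2,1}_{Δ,0}(Ω)` with Laplacian `f`: `u` is an L¹(Ω) limit of test functions `φ k`
with `Δ(φ k) → f` in L¹(Ω) (closure of C_c^∞(Ω) in the norm ‖Δu‖₁). -/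
def MemW21Delta0 (n : ℕ) (Ω : Set (Euc n)) (u f : Euc n → ℝ) : Prop :=
  IntegrableOn u Ω volume ∧ IntegrableOn f Ω volume ∧
  ∃ φ : ℕ → Euc n → ℝ, (∀ k, IsTestFun n Ω (φ k)) ∧
    Tendsto (fun k => ∫ x in Ω, |φ k x - u x|) atTop (𝓝 0) ∧
    Tendsto (fun k => ∫ x in Ω, |lapl n (φ k) x - f x|) atTop (𝓝 0)

/-- The decreasing rearrangement `u*(t)` of `u` on Ω. -/
def decRearr (n : ℕ) (Ω : Set (Euc n)) (u : Euc n → ℝ) (t : ℝ) : ℝ :=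
  sInf {s : ℝ | 0 ≤ s ∧ volume {x ∈ Ω | s < |u x|} ≤ ENNReal.ofReal t}

/-- `‖f‖_{L¹(Ω)}`. -/
def L1norm (n : ℕ) (Ω : Set (Euc n)) (f : Euc n → ℝ) : ℝ := ∫ x in Ω, |f x|

/-- ω_{n-1}: surface measure of the unit sphere in ℝⁿ. -/
def omegaS (n : ℕ) : ℝ := 2 * Real.pi ^ ((n : ℝ) / 2) / Real.Gamma ((n : ℝ) / 2)

/-- c_n = 1/((n-2) ω_{n-1}). -/
def cConst (n : ℕ) : ℝ := 1 / (((n : ℝ) - 2) * omegaS n)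

/-- `N*_V(t)`: the rearrangement of the Green function of the ball of volume V. -/
def NstarV (n : ℕ) (V t : ℝ) : ℝ :=
  if n = 2 then (1 / (4 * Real.pi)) * Real.log (V / t)
  else cConst n * (omegaS n / (n : ℝ)) ^ (((n : ℝ) - 2) / (n : ℝ)) *
    (t ^ (-(((n : ℝ) - 2) / (n : ℝ))) - V ^ (-(((n : ℝ) - 2) / (n : ℝ))))

/-- `N*_∞(t)` (for n ≥ 3). -/
def NstarInf (n : ℕ) (t : ℝ) : ℝ :=
  cConst n * (omegaS n / (n : ℝ)) ^ (((n : ℝ) - 2) / (n : ℝ)) *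
    t ^ (-(((n : ℝ) - 2) / (n : ℝ)))

/-- The maximal function `u**(t) = (1/t) ∫₀ᵗ u*(s) ds`. -/
def maximalFn (n : ℕ) (Ω : Set (Euc n)) (u : Euc n → ℝ) (t : ℝ) : ℝ :=
  (1 / t) * ∫ s in (0:ℝ)..t, decRearr n Ω u s

/-- `u ∈ L_exp(Ω)`. -/
def MemLexp (n : ℕ) (Ω : Set (Euc n)) (u : Euc n → ℝ) : Prop :=
  ∃ M : ℝ, ∀ t : ℝ, 0 < t → t ≤ (volume Ω).toReal →
    decRearr n Ω u t / (1 + Real.log ((volume Ω).toReal / t)) ≤ M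

/-- `u ∈ L_{exp,0}(Ω)`. -/
def MemLexp0 (n : ℕ) (Ω : Set (Euc n)) (u : Euc n → ℝ) : Prop :=
  MemLexp n Ω u ∧
    Tendsto (fun t : ℝ => maximalFn n Ω u t / Real.log (1 / t)) (𝓝[>] 0) (𝓝 0)

/-- `u ∈ L^{n/(n-2),∞}(Ω)`. -/
def MemWeakL (n : ℕ) (Ω : Set (Euc n)) (u : Euc n → ℝ) : Prop :=
  ∃ M : ℝ, ∀ t : ℝ, 0 < t → t ≤ (volume Ω).toReal →
    t ^ (((n : ℝ) - 2) / (n : ℝ)) * decRearr n Ω u t ≤ M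

/-- `u ∈ L₀^{n/(n-2),∞}(Ω)`. -/
def MemWeakL0 (n : ℕ) (Ω : Set (Euc n)) (u : Euc n → ℝ) : Prop :=
  MemWeakL n Ω u ∧
    Tendsto (fun t : ℝ => t ^ (((n : ℝ) - 2) / (n : ℝ)) * maximalFn n Ω u t) (𝓝[>] 0) (𝓝 0)

/-- `Λ_n^0(Ω)`: equals `L_{exp,0}(Ω)` if n = 2 and `L₀^{n/(n-2),∞}(Ω)` if n ≥ 3. -/
def MemLambda0 (n : ℕ) (Ω : Set (Euc n)) (u : Euc n → ℝ) : Prop :=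
  if n = 2 then MemLexp0 n Ω u else MemWeakL0 n Ω u

/-- The one-dimensional Brunn–Minkowski inequality. -/
lemma volume_add_volume_le_of_add_mem {P Q R : Set ℝ} (hP : MeasurableSet P)
    (hQ : MeasurableSet Q) (hP0 : P.Nonempty) (hQ0 : Q.Nonempty)
    (h : ∀ x ∈ P, ∀ y ∈ Q, x + y ∈ R) : volume P + volume Q ≤ volume R := by
  have compact_case : ∀ K ⊆ P, ∀ L ⊆ Q, IsCompact K → IsCompact L → K.Nonempty → L.Nonempty →
      volume K + volume L ≤ volume R := by
    intro K hK L hL cK cL nK nL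
    obtain ⟨k, hk, hkmax⟩ := cK.exists_isGreatest nK
    obtain ⟨l, hl, hlmin⟩ := cL.exists_isLeast nL
    have h1 : volume K = volume ((fun x => x + l) '' K) := by
      simp
    have h2 : volume L = volume ((fun x => k + x) '' L) := by
      simp
    have hd : AEDisjoint volume ((fun x => x + l) '' K) ((fun x => k + x) '' L) := by
      refine measure_mono_null (t := {k + l}) ?_ (by simp)
      rintro _ ⟨⟨x, hx, rfl⟩, ⟨y, hy, hxy⟩⟩
      have a1 := hkmax hx
      have a2 := hlmin hy
      simp only [Set.mem_singleton_iff] at *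
      linarith
    rw [h1, h2, ← measure_union₀ ((cL.image (by fun_prop)).measurableSet.nullMeasurableSet) hd]
    refine measure_mono ?_
    rintro _ (⟨x, hx, rfl⟩ | ⟨y, hy, rfl⟩)
    · exact h _ (hK hx) _ (hL hl)
    · exact h _ (hK hk) _ (hL hy)
  have approx : ∀ S : Set ℝ, MeasurableSet S → S.Nonempty → ∀ r < volume S,
      ∃ K ⊆ S, IsCompact K ∧ K.Nonempty ∧ r < volume K := by
    intro S hS _ r hr
    obtain ⟨K, hKS, hK, hrK⟩ := hS.exists_lt_isCompact hr
    refine ⟨K, hKS, hK, ?_, hrK⟩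
    by_contra hn
    simp [Set.not_nonempty_iff_eq_empty.1 hn] at hrK
  have bound : ∀ S : Set ℝ, MeasurableSet S → S.Nonempty → ∀ c d : ℝ≥0∞,
      (∀ K ⊆ S, IsCompact K → K.Nonempty → volume K + c ≤ d) → volume S + c ≤ d := by
    intro S hS hS0 c d hc
    obtain ⟨x, hx⟩ := hS0
    have hcd : c ≤ d := le_trans le_add_self
      (hc {x} (by simpa using hx) isCompact_singleton (Set.singleton_nonempty x))
    by_cases hct : c = ∞
    · rw [hct, top_le_iff] at hcd
      simp [hcd]
    refine (ENNReal.le_sub_iff_add_le_right hct hcd).1 ?_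
    refine le_of_forall_lt fun r hr => ?_
    obtain ⟨K, hKS, hK, hK0, hrK⟩ := approx S hS ⟨x, hx⟩ r hr
    exact hrK.trans_le (ENNReal.le_sub_of_add_le_right hct (hc K hKS hK hK0))
  refine bound P hP hP0 _ _ fun K hKP hK hK0 => ?_
  rw [add_comm]
  refine bound Q hQ hQ0 _ _ fun L hLQ hL hL0 => ?_
  rw [add_comm]
  exact compact_case K hKP L hLQ hK hL hK0 hL0

lemma ENNReal.rpow_mul_rpow_le_weighted {a b : ℝ} (ha : 0 < a) (hb : 0 < b) (hab : a + b = 1)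
    (x y : ℝ≥0∞) : x ^ a * y ^ b ≤ ENNReal.ofReal a * x + ENNReal.ofReal b * y := by
  by_cases hx : x = ∞
  · simp [hx, ENNReal.mul_top, ha]
  by_cases hy : y = ∞
  · simp [hy, ENNReal.mul_top, hb]
  lift x to NNReal using hx
  lift y to NNReal using hy
  lift a to NNReal using ha.le
  lift b to NNReal using hb.le
  have := NNReal.geom_mean_le_arith_mean2_weighted a b x y (by exact_mod_cast hab)
  rw [← ENNReal.coe_rpow_of_nonneg _ ha.le, ← ENNReal.coe_rpow_of_nonneg _ hb.le]
  simp only [ENNReal.ofReal_coe_nnreal]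
  exact_mod_cast this

lemma lintegral_eq_lintegral_Ioo_meas_lt {p : ℝ → ℝ≥0∞} (hp : Measurable p)
    (hp1 : ∀ x, p x ≤ 1) :
    ∫⁻ x, p x = ∫⁻ s in Set.Ioo (0:ℝ) 1, volume {x | ENNReal.ofReal s < p x} := by
  have htop : ∀ x, p x ≠ ∞ := fun x => ((hp1 x).trans_lt ENNReal.one_lt_top).ne
  have h1 : ∫⁻ x, p x = ∫⁻ x, ENNReal.ofReal (p x).toReal := by
    simp only [ENNReal.ofReal_toReal (htop _)]
  rw [h1, lintegral_eq_lintegral_meas_lt _ (ae_of_all _ fun x => ENNReal.toReal_nonneg)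
    hp.ennreal_toReal.aemeasurable]
  rw [← Set.Ioo_union_Ici_eq_Ioi (zero_lt_one' ℝ), lintegral_union measurableSet_Ici
    (Set.disjoint_left.2 fun x hx hx' => not_le.2 hx.2 hx')]
  have h2 : ∫⁻ s in Set.Ici (1:ℝ), volume {x | s < (p x).toReal} = 0 := by
    rw [setLIntegral_congr_fun (g := fun _ => 0) measurableSet_Ici]
    · simp
    · intro s hs
      have : {x | s < (p x).toReal} = ∅ := by
        ext x
        simp only [Set.mem_ofPred_eq, Set.mem_empty_iff_false, iff_false, not_lt]
        refine le_trans ?_ hs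
        exact ENNReal.toReal_le_of_le_ofReal zero_le_one (by simpa using hp1 x)
      simp [this]
  rw [h2, add_zero]
  refine setLIntegral_congr_fun measurableSet_Ioo fun s hs => ?_
  simp only [ENNReal.ofReal_lt_iff_lt_toReal hs.1.le (htop _)]

open scoped Pointwise in
lemma prekopaLeindler_real_of_sup_eq_one {a b : ℝ} (ha : 0 < a) (hb : 0 < b) (hab : a + b = 1)
    {f g h : ℝ → ℝ≥0∞} (hf : Measurable f) (hg : Measurable g) (hh : Measurable h)
    (hf1 : ∀ x, f x ≤ 1) (hg1 : ∀ x, g x ≤ 1)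
    (hf2 : ∀ s < 1, ∃ x, s < f x) (hg2 : ∀ s < 1, ∃ x, s < g x)
    (H : ∀ x y, f x ^ a * g y ^ b ≤ h (a * x + b * y)) :
    (∫⁻ x, f x) ^ a * (∫⁻ x, g x) ^ b ≤ ∫⁻ x, h x := by
  refine (ENNReal.rpow_mul_rpow_le_weighted ha hb hab _ _).trans ?_
  have hmin : ∫⁻ x, min (h x) 1 ≤ ∫⁻ x, h x := lintegral_mono fun x => min_le_left _ _
  refine le_trans ?_ hmin
  rw [lintegral_eq_lintegral_Ioo_meas_lt hf hf1, lintegral_eq_lintegral_Ioo_meas_lt hg hg1,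
    lintegral_eq_lintegral_Ioo_meas_lt (hh.min measurable_const) fun x => min_le_right _ _]
  have anti : ∀ p : ℝ → ℝ≥0∞, Measurable fun s : ℝ => volume {x | ENNReal.ofReal s < p x} := by
    intro p
    refine Antitone.measurable fun s t hst => measure_mono fun x hx => ?_
    exact (ENNReal.ofReal_le_ofReal hst).trans_lt hx
  rw [← lintegral_const_mul _ (anti f), ← lintegral_const_mul _ (anti g),
    ← lintegral_add_left ((anti f).const_mul _)]
  refine setLIntegral_mono (anti _) fun s hs => ?_
  have hs1 : ENNReal.ofReal s < 1 := by simpa using hs.2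
  obtain ⟨x0, hx0⟩ := hf2 _ hs1
  obtain ⟨y0, hy0⟩ := hg2 _ hs1
  have e : ∀ (c : ℝ), 0 < c → ∀ S : Set ℝ, ENNReal.ofReal c * volume S = volume (c • S) := by
    intro c hc S
    rw [Measure.addHaar_smul]
    simp [abs_of_pos hc]
  rw [e a ha, e b hb]
  refine volume_add_volume_le_of_add_mem
    ((measurableSet_lt measurable_const hf).const_smul₀ a)
    ((measurableSet_lt measurable_const hg).const_smul₀ b)
    (Set.Nonempty.smul_set ⟨x0, hx0⟩) (Set.Nonempty.smul_set ⟨y0, hy0⟩) ?_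
  rintro _ ⟨x, hx, rfl⟩ _ ⟨y, hy, rfl⟩
  simp only [Set.mem_ofPred_eq, smul_eq_mul] at hx hy ⊢
  refine lt_min (lt_of_lt_of_le ?_ (H x y)) hs1
  have es : ENNReal.ofReal s = ENNReal.ofReal s ^ a * ENNReal.ofReal s ^ b := by
    rw [← ENNReal.rpow_add _ _ (by simpa using hs.1) ENNReal.ofReal_ne_top, hab, ENNReal.rpow_one]
  rw [es]
  exact ENNReal.mul_lt_mul (ENNReal.rpow_lt_rpow hx ha) (ENNReal.rpow_lt_rpow hy hb)

lemma prekopaLeindler_real_of_bounded {a b : ℝ} (ha : 0 < a) (hb : 0 < b) (hab : a + b = 1)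
    {f g h : ℝ → ℝ≥0∞} (hf : Measurable f) (hg : Measurable g) (hh : Measurable h)
    {k : ℝ≥0∞} (hk : k ≠ ∞) (hfk : ∀ x, f x ≤ k) (hgk : ∀ x, g x ≤ k)
    (H : ∀ x y, f x ^ a * g y ^ b ≤ h (a * x + b * y)) :
    (∫⁻ x, f x) ^ a * (∫⁻ x, g x) ^ b ≤ ∫⁻ x, h x := by
  set F := ⨆ x, f x with hF
  set G := ⨆ x, g x with hG
  have hFt : F ≠ ∞ := ((iSup_le hfk).trans_lt hk.lt_top).ne
  have hGt : G ≠ ∞ := ((iSup_le hgk).trans_lt hk.lt_top).ne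
  by_cases hF0 : F = 0
  · have : ∀ x, f x = 0 := fun x =>
      le_zero_iff.1 ((le_iSup f x).trans_eq (hF.symm.trans hF0))
    simp [this, ha]
  by_cases hG0 : G = 0
  · have : ∀ x, g x = 0 := fun x =>
      le_zero_iff.1 ((le_iSup g x).trans_eq (hG.symm.trans hG0))
    simp [this, hb]
  have hFa0 : F ^ a ≠ 0 := by simp [hF0, hFt]
  have hGb0 : G ^ b ≠ 0 := by simp [hG0, hGt]
  have hFat : F ^ a ≠ ∞ := by simp [hF0, hFt]
  have hGbt : G ^ b ≠ ∞ := by simp [hG0, hGt]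
  have key := prekopaLeindler_real_of_sup_eq_one (f := fun x => f x / F) (g := fun x => g x / G)
    (h := fun x => h x / (F ^ a * G ^ b)) ha hb hab (hf.div_const _) (hg.div_const _)
    (hh.div_const _)
    (fun x => ENNReal.div_le_of_le_mul (by simpa using le_iSup f x))
    (fun x => ENNReal.div_le_of_le_mul (by simpa using le_iSup g x))
    (fun s hs => ?_) (fun s hs => ?_) (fun x y => ?_)
  · simp only [div_eq_mul_inv] at key
    rw [lintegral_mul_const _ hf, lintegral_mul_const _ hg, lintegral_mul_const _ hh,
      ENNReal.mul_rpow_of_nonneg _ _ ha.le, ENNReal.mul_rpow_of_nonneg _ _ hb.le,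
      ENNReal.inv_rpow, ENNReal.inv_rpow, mul_mul_mul_comm,
      ← ENNReal.mul_inv (Or.inl hFa0) (Or.inl hFat)] at key
    have hc0 : F ^ a * G ^ b ≠ 0 := mul_ne_zero hFa0 hGb0
    have hct : F ^ a * G ^ b ≠ ∞ := ENNReal.mul_ne_top hFat hGbt
    exact (ENNReal.mul_le_mul_iff_left (ENNReal.inv_ne_zero.2 hct) (ENNReal.inv_ne_top.2 hc0)).1 key
  · have : s * F < F := by
      simpa using ENNReal.mul_lt_mul_left hF0 hFt hs
    obtain ⟨x, hx⟩ := lt_iSup_iff.1 this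
    exact ⟨x, (ENNReal.lt_div_iff_mul_lt (Or.inl hF0) (Or.inl hFt)).2 hx⟩
  · have : s * G < G := by
      simpa using ENNReal.mul_lt_mul_left hG0 hGt hs
    obtain ⟨x, hx⟩ := lt_iSup_iff.1 this
    exact ⟨x, (ENNReal.lt_div_iff_mul_lt (Or.inl hG0) (Or.inl hGt)).2 hx⟩
  · simp only [div_eq_mul_inv]
    rw [ENNReal.mul_rpow_of_nonneg _ _ ha.le, ENNReal.mul_rpow_of_nonneg _ _ hb.le,
      ENNReal.inv_rpow, ENNReal.inv_rpow, mul_mul_mul_comm,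
      ← ENNReal.mul_inv (Or.inl hFa0) (Or.inl hFat)]
    gcongr
    exact H x y

lemma prekopaLeindler_real {a b : ℝ} (ha : 0 < a) (hb : 0 < b) (hab : a + b = 1)
    {f g h : ℝ → ℝ≥0∞} (hf : Measurable f) (hg : Measurable g) (hh : Measurable h)
    (H : ∀ x y, f x ^ a * g y ^ b ≤ h (a * x + b * y)) :
    (∫⁻ x, f x) ^ a * (∫⁻ x, g x) ^ b ≤ ∫⁻ x, h x := by
  by_cases hf0 : ∫⁻ x, f x = 0
  · simp [hf0, ha]
  by_cases hg0 : ∫⁻ x, g x = 0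
  · simp [hg0, hb]
  have key : ∀ k : ℕ, (∫⁻ x, min (f x) k) ^ a * (∫⁻ x, min (g x) k) ^ b ≤ ∫⁻ x, h x := by
    intro k
    refine prekopaLeindler_real_of_bounded ha hb hab (hf.min measurable_const)
      (hg.min measurable_const) hh (k := k) (by simp) (fun x => min_le_right _ _)
      (fun x => min_le_right _ _) fun x y => le_trans ?_ (H x y)
    gcongr <;> exact min_le_left _ _
  have lim : ∀ p : ℝ → ℝ≥0∞, Measurable p →
      Tendsto (fun k : ℕ => ∫⁻ x, min (p x) k) atTop (𝓝 (∫⁻ x, p x)) := by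
    intro p hp
    refine lintegral_tendsto_of_tendsto_of_monotone
      (fun k => (hp.min measurable_const).aemeasurable)
      (ae_of_all _ fun x k l hkl => min_le_min_left _ (by exact_mod_cast hkl))
      (ae_of_all _ fun x => ?_)
    have := (tendsto_const_nhds (x := p x)).min ENNReal.tendsto_nat_nhds_top
    simpa using this
  refine le_of_tendsto' (ENNReal.Tendsto.mul ((lim f hf).ennrpow_const a) (Or.inl ?_)
    ((lim g hg).ennrpow_const b) (Or.inl ?_)) key
  · simp [hf0, ha, not_lt.2 ha.le]
  · simp [hg0, hb, not_lt.2 hb.le]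

/-- The Prékopa–Leindler inequality. -/
theorem prekopaLeindler {a b : ℝ} (ha : 0 < a) (hb : 0 < b) (hab : a + b = 1) (n : ℕ)
    {f g h : (Fin n → ℝ) → ℝ≥0∞} (hf : Measurable f) (hg : Measurable g) (hh : Measurable h)
    (H : ∀ x y, f x ^ a * g y ^ b ≤ h (a • x + b • y)) :
    (∫⁻ x, f x) ^ a * (∫⁻ x, g x) ^ b ≤ ∫⁻ x, h x := by
  induction n with
  | zero =>
    simp only [volume_pi, Measure.pi_of_empty _ (0 : Fin 0 → ℝ), lintegral_dirac]
    simpa using H 0 0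
  | succ n ih =>
    have mp := (volume_preserving_piFinSuccAbove (fun _ : Fin (n + 1) => ℝ) 0).symm
    have split : ∀ p : (Fin (n + 1) → ℝ) → ℝ≥0∞, Measurable p →
        ∫⁻ x, p x = ∫⁻ t : ℝ, ∫⁻ z : Fin n → ℝ, p (Fin.cons t z) := by
      intro p hp
      rw [← mp.lintegral_comp hp, Measure.volume_eq_prod, lintegral_prod
        (fun q => p ((MeasurableEquiv.piFinSuccAbove (fun _ : Fin (n + 1) => ℝ) 0).symm q))
        (hp.comp (MeasurableEquiv.measurable _)).aemeasurable]
      simp [MeasurableEquiv.piFinSuccAbove, Fin.insertNthEquiv]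
    have mcons : Measurable fun q : ℝ × (Fin n → ℝ) => (Fin.cons q.1 q.2 : Fin (n + 1) → ℝ) := by
      refine measurable_pi_iff.2 fun i => ?_
      refine Fin.cases ?_ (fun j => ?_) i
      · simpa using measurable_fst
      · simpa using show Measurable fun q : ℝ × (Fin n → ℝ) => q.2 j from
          (measurable_pi_apply j).comp measurable_snd
    have msec : ∀ p : (Fin (n + 1) → ℝ) → ℝ≥0∞, Measurable p →
        Measurable fun t : ℝ => ∫⁻ z : Fin n → ℝ, p (Fin.cons t z) := fun p hp =>
      (hp.comp mcons).lintegral_prod_right'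
    have mz : ∀ (p : (Fin (n + 1) → ℝ) → ℝ≥0∞) (t : ℝ), Measurable p →
        Measurable fun z : Fin n → ℝ => p (Fin.cons t z) := fun p t hp =>
      hp.comp (mcons.comp (measurable_const.prodMk measurable_id))
    rw [split f hf, split g hg, split h hh]
    refine prekopaLeindler_real ha hb hab (msec f hf) (msec g hg) (msec h hh) fun s t => ?_
    refine ih (mz f s hf) (mz g t hg) (mz h _ hh) fun x y => ?_
    refine (H _ _).trans_eq ?_
    congr 1
    ext i
    refine Fin.cases ?_ (fun j => ?_) i <;> simp

/-- The multiplicative form of the Brunn–Minkowski inequality. -/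
theorem volume_rpow_mul_volume_rpow_le {n : ℕ} {a b : ℝ} (ha : 0 < a) (hb : 0 < b)
    (hab : a + b = 1) {A B D : Set (Euc n)} (hA : MeasurableSet A) (hB : MeasurableSet B)
    (hD : MeasurableSet D) (H : ∀ x ∈ A, ∀ y ∈ B, a • x + b • y ∈ D) :
    volume A ^ a * volume B ^ b ≤ volume D := by
  have mp := PiLp.volume_preserving_toLp (Fin n)
  have vol : ∀ S : Set (Euc n), MeasurableSet S →
      volume S = ∫⁻ x : Fin n → ℝ, S.indicator 1 (WithLp.toLp 2 x) := by
    intro S hS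
    rw [mp.lintegral_comp (measurable_one.indicator hS), lintegral_indicator_one hS]
  rw [vol A hA, vol B hB, vol D hD]
  refine prekopaLeindler ha hb hab n ((measurable_one.indicator hA).comp mp.measurable)
    ((measurable_one.indicator hB).comp mp.measurable)
    ((measurable_one.indicator hD).comp mp.measurable) fun x y => ?_
  by_cases hx : WithLp.toLp 2 x ∈ A
  · by_cases hy : WithLp.toLp 2 y ∈ B
    · have := H _ hx _ hy
      simp [hx, hy, this]
    · simp [hy, hb]
  · simp [hx, ha]

/-- The volume of the unit ball of `ℝⁿ`. -/
def unitBallVol (n : ℕ) : ℝ := (volume (Metric.ball (0 : Euc n) 1)).toReal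

lemma unitBallVol_pos (n : ℕ) : 0 < unitBallVol n :=
  ENNReal.toReal_pos (Metric.measure_ball_pos _ _ one_pos).ne' measure_ball_lt_top.ne

/-- The isoperimetric constant of `ℝⁿ`. -/
def isoperimetricConst (n : ℕ) : ℝ := n * unitBallVol n ^ (1 / (n : ℝ))

open scoped Pointwise in
/-- A linearised Brunn–Minkowski inequality for the `ε`-neighbourhood of a set. -/
theorem volume_add_le_volume_of_neighborhood {n : ℕ} (hn : 2 ≤ n) {A D : Set (Euc n)}
    (hA : MeasurableSet A) (hD : MeasurableSet D) (hDt : volume D ≠ ∞) {ε : ℝ} (hε : 0 < ε)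
    (H : ∀ x ∈ A, ∀ y, ‖y‖ < ε → x + y ∈ D) :
    (volume A).toReal + ε * (isoperimetricConst n * (volume A).toReal ^ (1 - 1 / (n : ℝ))) ≤
      (volume D).toReal := by
  have hn0 : (0 : ℝ) < n := by positivity
  have hAD : volume A ≤ volume D := measure_mono fun x hx => by
    simpa using H x hx 0 (by simpa using hε)
  have hAt : volume A ≠ ∞ := (hAD.trans_lt hDt.lt_top).ne
  set v := (volume A).toReal with hv
  have hv0 : 0 ≤ v := ENNReal.toReal_nonneg
  rcases hv0.eq_or_lt with h0 | hvpos
  · have : (1 : ℝ) - 1 / n ≠ 0 := by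
      have : (2 : ℝ) ≤ n := by exact_mod_cast hn
      have : 1 / (n : ℝ) ≤ 1 / 2 := one_div_le_one_div_of_le (by norm_num) this
      linarith
    rw [← h0, Real.zero_rpow this]
    simp
  set α := v ^ (1 / (n : ℝ)) with hα
  set β := ε * unitBallVol n ^ (1 / (n : ℝ)) with hβ
  have hα0 : 0 < α := Real.rpow_pos_of_pos hvpos _
  have hβ0 : 0 < β := mul_pos hε (Real.rpow_pos_of_pos (unitBallVol_pos n) _)
  have rp : ∀ z : ℝ, 0 ≤ z → (z ^ (1 / (n : ℝ))) ^ n = z := by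
    intro z hz
    rw [one_div, Real.rpow_inv_natCast_pow hz (by omega)]
  have hs : 0 < α + β := by positivity
  have hvA : volume A = ENNReal.ofReal (α ^ n) := by
    rw [hα, rp v hv0, hv, ENNReal.ofReal_toReal hAt]
  have hvB : volume (Metric.ball (0 : Euc n) ε) = ENNReal.ofReal (β ^ n) := by
    rw [Measure.addHaar_ball_of_pos _ _ hε, hβ, mul_pow, rp _ (unitBallVol_pos n).le,
      ENNReal.ofReal_mul (by positivity), unitBallVol,
      ENNReal.ofReal_toReal measure_ball_lt_top.ne]
    simp
  have key := volume_rpow_mul_volume_rpow_le (a := α / (α + β)) (b := β / (α + β))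
    (A := (α / (α + β))⁻¹ • A) (B := (β / (α + β))⁻¹ • Metric.ball (0 : Euc n) ε) (D := D)
    (by positivity) (by positivity) (by field_simp) (hA.const_smul₀ _)
    (measurableSet_ball.const_smul₀ _) hD ?_
  · have sc : ∀ γ : ℝ, 0 < γ → ENNReal.ofReal |(γ / (α + β))⁻¹ ^ n| * ENNReal.ofReal (γ ^ n) =
        ENNReal.ofReal ((α + β) ^ n) := by
      intro γ hγ
      rw [← ENNReal.ofReal_mul (abs_nonneg _), abs_of_pos (by positivity), ← mul_pow]
      congr 2
      field_simp
    rw [Measure.addHaar_smul, Measure.addHaar_smul, hvA, hvB, finrank_euclideanSpace,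
      Fintype.card_fin, sc α hα0, sc β hβ0, ← ENNReal.rpow_add_of_nonneg _ _ (by positivity)
      (by positivity), ← add_div, div_self hs.ne', ENNReal.rpow_one,
      ENNReal.ofReal_le_iff_le_toReal hDt] at key
    refine le_trans ?_ key
    have bern : α ^ n + n * α ^ (n - 1) * β ≤ (α + β) ^ n := by
      have h1 := one_add_mul_le_pow (a := β / α) (by
        have : 0 ≤ β / α := by positivity
        linarith) n
      have h2 : (α + β) ^ n = α ^ n * (1 + β / α) ^ n := by
        rw [← mul_pow]
        congr 1
        field_simp
      have h3 : α ^ n = α ^ (n - 1) * α := by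
        rw [← pow_succ]
        congr 1
        omega
      calc α ^ n + n * α ^ (n - 1) * β = α ^ n * (1 + n * (β / α)) := by
            rw [h3]
            field_simp
        _ ≤ _ := by
            rw [h2]
            gcongr
    refine le_trans (le_of_eq ?_) bern
    have h4 : α ^ (n - 1) = v ^ (1 - 1 / (n : ℝ)) := by
      rw [hα, ← Real.rpow_natCast, ← Real.rpow_mul hv0, Nat.cast_sub (by omega)]
      congr 1
      field_simp
      simp
    rw [h4, hα, rp v hv0, hβ, isoperimetricConst]
    ring
  · rintro _ ⟨x, hx, rfl⟩ _ ⟨y, hy, rfl⟩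
    have ha : α / (α + β) ≠ 0 := by positivity
    have hb : β / (α + β) ≠ 0 := by positivity
    simp only [smul_smul, mul_inv_cancel₀ ha, mul_inv_cancel₀ hb, one_smul]
    exact H x hx y (by simpa using hy)

/-- The distribution function `t ↦ |{u > t}|`. -/
def distribFn {n : ℕ} (u : Euc n → ℝ) (t : ℝ) : ℝ := (volume {x | t < u x}).toReal

lemma volume_superlevel_ne_top {n : ℕ} {u : Euc n → ℝ} (hc : HasCompactSupport u) {t : ℝ}
    (ht : 0 ≤ t) : volume {x | t < u x} ≠ ∞ := by
  refine ((measure_mono fun x hx => subset_tsupport u ?_).trans_lt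
    hc.isCompact.measure_lt_top).ne
  exact (ht.trans_lt hx).ne'

lemma distribFn_nonneg {n : ℕ} (u : Euc n → ℝ) (t : ℝ) : 0 ≤ distribFn u t :=
  ENNReal.toReal_nonneg

lemma distribFn_anti {n : ℕ} {u : Euc n → ℝ} (hc : HasCompactSupport u) {s t : ℝ}
    (hs : 0 ≤ s) (hst : s ≤ t) : distribFn u t ≤ distribFn u s :=
  ENNReal.toReal_mono (volume_superlevel_ne_top hc hs) (measure_mono fun _ hx => hst.trans_lt hx)

/-- First order Taylor expansion with a uniform remainder. -/
lemma exists_forall_le_add_norm_fderiv {n : ℕ} {u : Euc n → ℝ} (hu : ContDiff ℝ 2 u)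
    (hc : HasCompactSupport u) :
    ∃ C, 0 ≤ C ∧ ∀ x y, u x ≤ u (x + y) + ‖fderiv ℝ u (x + y)‖ * ‖y‖ + C * ‖y‖ ^ 2 := by
  obtain ⟨C, hC⟩ := ContDiff.lipschitzWith_of_hasCompactSupport (hc.fderiv ℝ)
    (hu.fderiv_right (m := 1) (by norm_num)) one_ne_zero
  refine ⟨C, C.2, fun x y => ?_⟩
  have h := (convex_closedBall (x + y) ‖y‖).norm_image_sub_le_of_norm_fderiv_le' (𝕜 := ℝ) (f := u)
    (φ := fderiv ℝ u (x + y)) (x := x + y) (y := x) (C := C * ‖y‖)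
    (fun z _ => (hu.differentiable (by norm_num)).differentiableAt) (fun z hz => ?_)
    (Metric.mem_closedBall_self (norm_nonneg y)) (by simp)
  · have h2 : x - (x + y) = -y := by abel
    rw [h2, norm_neg] at h
    have h3 := (abs_le.1 h).2
    have h4 : (fderiv ℝ u (x + y)) (-y) ≤ ‖fderiv ℝ u (x + y)‖ * ‖y‖ := by
      have := (fderiv ℝ u (x + y)).le_opNorm (-y)
      rw [norm_neg] at this
      exact (le_abs_self _).trans this
    nlinarith
  · rw [← dist_eq_norm]
    refine (hC.dist_le_mul _ _).trans ?_
    gcongr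
    exact hz

/-- The primitive of a bump function vanishing at the origin. -/
def bumpPrim {c : ℝ} (ψ : ContDiffBump c) (t : ℝ) : ℝ := ∫ x in (0:ℝ)..t, ψ x

section bumpPrim

variable {c : ℝ} (ψ : ContDiffBump c)

lemma hasDerivAt_bumpPrim (t : ℝ) : HasDerivAt (bumpPrim ψ) (ψ t) t :=
  intervalIntegral.integral_hasDerivAt_right (ψ.continuous.intervalIntegrable _ _)
    ψ.continuous.stronglyMeasurable.stronglyMeasurableAtFilter ψ.continuous.continuousAt

lemma continuous_bumpPrim : Continuous (bumpPrim ψ) :=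
  continuous_iff_continuousAt.2 fun t => (hasDerivAt_bumpPrim ψ t).continuousAt

lemma bumpPrim_sub_eq (a b : ℝ) : bumpPrim ψ b - bumpPrim ψ a = ∫ x in a..b, ψ x :=
  intervalIntegral.integral_interval_sub_left (ψ.continuous.intervalIntegrable _ _)
    (ψ.continuous.intervalIntegrable _ _)

lemma monotone_bumpPrim : Monotone (bumpPrim ψ) := fun a b hab => by
  rw [← sub_nonneg, bumpPrim_sub_eq]
  exact intervalIntegral.integral_nonneg hab fun x _ => ψ.nonneg

lemma bumpPrim_eq_zero {t : ℝ} (hs : ψ.rOut < c) (ht : t ≤ c - ψ.rOut) : bumpPrim ψ t = 0 := by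
  have h : Set.EqOn (fun x => ψ x) (fun _ => 0) (Set.uIcc 0 t) := fun x hx => by
    refine ψ.zero_of_le_dist ?_
    have : x ≤ c - ψ.rOut := hx.2.trans (sup_le (by linarith) ht)
    rw [dist_comm, Real.dist_eq]
    exact le_trans (by linarith) (le_abs_self _)
  rw [bumpPrim, intervalIntegral.integral_congr h]
  simp

lemma bumpPrim_nonneg (hs : ψ.rOut < c) (t : ℝ) : 0 ≤ bumpPrim ψ t := by
  rw [← bumpPrim_eq_zero ψ hs (min_le_right t _)]
  exact monotone_bumpPrim ψ (min_le_left _ _)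

lemma bumpPrim_le_integral (t : ℝ) : bumpPrim ψ t ≤ ∫ x, ψ x := by
  refine (monotone_bumpPrim ψ (le_max_right 0 t)).trans ?_
  rw [bumpPrim, intervalIntegral.integral_of_le (le_max_left _ _)]
  exact setIntegral_le_integral ψ.integrable (ae_of_all _ fun _ => ψ.nonneg)

lemma exists_bumpPrim_sub_le : ∃ K, 0 ≤ K ∧ ∀ a b, a ≤ b →
    bumpPrim ψ b - bumpPrim ψ a ≤ ψ a * (b - a) + K * (b - a) ^ 2 := by
  obtain ⟨K, hK⟩ := ContDiff.lipschitzWith_of_hasCompactSupport ψ.hasCompactSupport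
    (ψ.contDiff (n := 1)) one_ne_zero
  refine ⟨K, K.2, fun a b hab => ?_⟩
  rw [bumpPrim_sub_eq]
  have : ∫ x in a..b, ψ x ≤ ∫ x in a..b, (ψ a + K * (b - a)) := by
    refine intervalIntegral.integral_mono_on hab (ψ.continuous.intervalIntegrable _ _)
      (continuous_const.intervalIntegrable _ _) fun x hx => ?_
    have h1 := (le_abs_self _).trans (hK.dist_le_mul x a)
    have h2 : (K : ℝ) * dist x a ≤ K * (b - a) := by
      rw [Real.dist_eq, abs_of_nonneg (sub_nonneg.2 hx.1)]
      gcongr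
      exact hx.2
    linarith
  refine this.trans (le_of_eq ?_)
  rw [intervalIntegral.integral_const, smul_eq_mul]
  ring

end bumpPrim

/-- The layer cake formula for `bumpPrim ψ ∘ w`. -/
lemma lintegral_bumpPrim_eq {n : ℕ} {c : ℝ} (ψ : ContDiffBump c) (hs : ψ.rOut < c)
    {w : Euc n → ℝ} (hw : Measurable w) :
    ∫⁻ x, ENNReal.ofReal (bumpPrim ψ (w x)) =
      ∫⁻ t in Set.Ioi 0, volume {x | t < w x} * ENNReal.ofReal (ψ t) := by
  have h := lintegral_comp_eq_lintegral_meas_lt_mul (volume : Measure (Euc n))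
    (f := fun x => max (w x) 0) (g := ψ) (ae_of_all _ fun x => le_max_right _ _)
    (hw.max measurable_const).aemeasurable (fun t _ => ψ.continuous.intervalIntegrable _ _)
    (ae_of_all _ fun t => ψ.nonneg)
  have h1 : ∀ x, bumpPrim ψ (w x) = ∫ t in (0:ℝ)..max (w x) 0, ψ t := by
    intro x
    rcases le_total 0 (w x) with h0 | h0
    · rw [max_eq_left h0, bumpPrim]
    · rw [max_eq_right h0, bumpPrim_eq_zero ψ hs (by linarith)]
      simp
  simp only [h1]
  rw [h]
  refine setLIntegral_congr_fun measurableSet_Ioi fun t ht => ?_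
  have : {a | t < max (w a) 0} = {a | t < w a} := by
    ext a
    simp [not_lt.2 (le_of_lt (Set.mem_Ioi.1 ht))]
  simp only [this]

/-- A weak form of the coarea formula combined with the isoperimetric inequality. -/
theorem isoperimetric_le_integral_norm_fderiv {n : ℕ} (hn : 2 ≤ n) {u : Euc n → ℝ}
    (hu : ContDiff ℝ 2 u) (hc : HasCompactSupport u) {c : ℝ} (ψ : ContDiffBump c)
    (hs : ψ.rOut < c) :
    isoperimetricConst n * distribFn u (c + ψ.rOut) ^ (1 - 1 / (n : ℝ)) * ∫ t, ψ t ≤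
      ∫ x, ψ (u x) * ‖fderiv ℝ u x‖ := by
  obtain ⟨C, hC0, hC⟩ := exists_forall_le_add_norm_fderiv hu hc
  obtain ⟨K, hK0, hK⟩ := exists_bumpPrim_sub_le ψ
  have hfc : Continuous (fderiv ℝ u) := hu.continuous_fderiv (by norm_num)
  obtain ⟨G, hG⟩ := (hc.fderiv ℝ).exists_bound_of_continuous hfc
  have hG0 : 0 ≤ G := (norm_nonneg _).trans (hG 0)
  set S := tsupport u with hS
  have hSt : volume S ≠ ∞ := hc.isCompact.measure_lt_top.ne
  set m := isoperimetricConst n * distribFn u (c + ψ.rOut) ^ (1 - 1 / (n : ℝ)) with hm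
  have hκ : 0 ≤ isoperimetricConst n :=
    mul_nonneg (by positivity) (Real.rpow_nonneg (unitBallVol_pos n).le _)
  have hm0 : 0 ≤ m := mul_nonneg hκ (Real.rpow_nonneg (distribFn_nonneg _ _) _)
  set R := (C + K * (G + C) ^ 2) * volume.real S with hR
  set F := ∫ x, ψ (u x) * ‖fderiv ℝ u x‖ with hF
  have hOutS : ∀ x ∉ S, u x = 0 := fun x hx => image_eq_zero_of_notMem_tsupport hx
  have hOutS' : ∀ x ∉ S, fderiv ℝ u x = 0 := fun x hx =>
    image_eq_zero_of_notMem_tsupport fun h => hx (tsupport_fderiv_subset ℝ h)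
  have hψ : ∀ t, ψ t ≠ 0 → c - ψ.rOut < t ∧ t < c + ψ.rOut := by
    intro t ht
    have : t ∈ Function.support ψ := ht
    rw [ψ.support_eq, Real.ball_eq_Ioo] at this
    exact this
  have main : ∀ ε : ℝ, 0 < ε → ε ≤ 1 → C * ε ^ 2 ≤ c - ψ.rOut →
      m * ∫ t, ψ t ≤ F + ε * R := by
    intro ε hε hε1 hεs
    set w : Euc n → ℝ := fun x => u x + ‖fderiv ℝ u x‖ * ε + C * ε ^ 2 with hw
    have hwc : Continuous w := by fun_prop
    have huw : ∀ x, u x ≤ w x := fun x => by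
      have : 0 ≤ ‖fderiv ℝ u x‖ * ε + C * ε ^ 2 := by positivity
      simp only [hw]
      linarith
    have hwS : ∀ x ∉ S, w x = C * ε ^ 2 := fun x hx => by
      simp [hw, hOutS x hx, hOutS' x hx]
    have bm : ∀ t, c - ψ.rOut < t → t < c + ψ.rOut →
        volume {x | t < u x} + ENNReal.ofReal (ε * m) ≤ volume {x | t < w x} := by
      intro t ht1 ht2
      have hwt : volume {x | t < w x} ≠ ∞ := by
        refine ((measure_mono fun x hx => ?_).trans_lt hSt.lt_top).ne
        by_contra hxS
        rw [Set.mem_ofPred_eq, hwS x hxS] at hx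
        linarith
      have h := volume_add_le_volume_of_neighborhood hn (A := {x | t < u x}) (D := {x | t < w x})
        (measurableSet_lt measurable_const hu.continuous.measurable)
        (measurableSet_lt measurable_const hwc.measurable) hwt hε fun x hx y hy => ?_
      · have hle : distribFn u (c + ψ.rOut) ≤ distribFn u t :=
          distribFn_anti hc (by linarith) ht2.le
        have h2 : (volume {x | t < u x}).toReal + ε * m ≤ (volume {x | t < w x}).toReal := by
          refine le_trans ?_ h
          gcongr
          refine mul_le_mul_of_nonneg_left ?_ hκ
          refine Real.rpow_le_rpow (distribFn_nonneg _ _) hle ?_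
          have : (1 : ℝ) ≤ n := by exact_mod_cast (by omega : 1 ≤ n)
          rw [sub_nonneg]
          exact (div_le_one (by linarith)).2 this
        rw [← ENNReal.ofReal_le_ofReal_iff ENNReal.toReal_nonneg,
          ENNReal.ofReal_add ENNReal.toReal_nonneg (by positivity), ENNReal.ofReal_toReal hwt,
          ENNReal.ofReal_toReal (volume_superlevel_ne_top hc (by linarith))] at h2
        exact h2
      · refine lt_of_lt_of_le hx ((hC x y).trans ?_)
        simp only [hw]
        gcongr
    have lower : (∫⁻ x, ENNReal.ofReal (bumpPrim ψ (u x))) +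
        ENNReal.ofReal (ε * m) * ENNReal.ofReal (∫ t, ψ t) ≤
        ∫⁻ x, ENNReal.ofReal (bumpPrim ψ (w x)) := by
      rw [lintegral_bumpPrim_eq ψ hs hu.continuous.measurable,
        lintegral_bumpPrim_eq ψ hs hwc.measurable,
        ofReal_integral_eq_lintegral_ofReal ψ.integrable (ae_of_all _ fun _ => ψ.nonneg)]
      have hψm : Measurable fun t => ENNReal.ofReal (ψ t) :=
        ψ.continuous.measurable.ennreal_ofReal
      have h0 : ∫⁻ t, ENNReal.ofReal (ψ t) = ∫⁻ t in Set.Ioi 0, ENNReal.ofReal (ψ t) := by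
        refine (setLIntegral_eq_of_support_subset ?_).symm
        intro t ht
        have : ψ t ≠ 0 := fun h => ht (by simp [h])
        have := hψ t this
        exact Set.mem_Ioi.2 (by linarith)
      rw [h0, ← lintegral_const_mul _ hψm, ← lintegral_add_right _ (hψm.const_mul _)]
      refine lintegral_mono fun t => ?_
      by_cases ht : ψ t = 0
      · simp [ht]
      · simp only
        rw [← add_mul]
        gcongr
        exact bm t (hψ t ht).1 (hψ t ht).2
    have outW : ∀ x ∉ S, bumpPrim ψ (w x) = 0 := fun x hx => by
      rw [hwS x hx]
      exact bumpPrim_eq_zero ψ hs hεs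
    have outU : ∀ x ∉ S, bumpPrim ψ (u x) = 0 := fun x hx => by
      rw [hOutS x hx]
      exact bumpPrim_eq_zero ψ hs (by linarith)
    have icS : ∀ p : Euc n → ℝ, Continuous p → IntegrableOn p S := fun p hp =>
      hp.continuousOn.integrableOn_compact hc.isCompact
    have icφ : ∀ p : Euc n → ℝ, Continuous p → (∀ x ∉ S, bumpPrim ψ (p x) = 0) →
        Integrable fun x => bumpPrim ψ (p x) := fun p hp h0 =>
      (icS _ ((continuous_bumpPrim ψ).comp hp)).integrable_of_forall_notMem_eq_zero h0
    have intU := icφ u hu.continuous outU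
    have intW := icφ w hwc outW
    rw [← ofReal_integral_eq_lintegral_ofReal intU (ae_of_all _ fun _ => bumpPrim_nonneg ψ hs _),
      ← ofReal_integral_eq_lintegral_ofReal intW (ae_of_all _ fun _ => bumpPrim_nonneg ψ hs _),
      ← ENNReal.ofReal_mul (by positivity), ← ENNReal.ofReal_add
        (integral_nonneg fun _ => bumpPrim_nonneg ψ hs _)
        (mul_nonneg (by positivity) (integral_nonneg fun _ => ψ.nonneg)),
      ENNReal.ofReal_le_ofReal_iff (integral_nonneg fun _ => bumpPrim_nonneg ψ hs _)] at lower
    have upper : (∫ x, bumpPrim ψ (w x)) - ∫ x, bumpPrim ψ (u x) ≤ ε * F + ε ^ 2 * R := by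
      rw [← integral_sub intW intU, ← setIntegral_eq_integral_of_forall_compl_eq_zero (s := S)
        (fun x hx => by rw [outW x hx, outU x hx, sub_zero])]
      have hFS : F = ∫ x in S, ψ (u x) * ‖fderiv ℝ u x‖ :=
        (setIntegral_eq_integral_of_forall_compl_eq_zero
          (fun x hx => by rw [hOutS' x hx]; simp)).symm
      have hcF : Continuous fun x => ψ (u x) * ‖fderiv ℝ u x‖ :=
        (ψ.continuous.comp hu.continuous).mul hfc.norm
      have hRS : ε ^ 2 * R = ∫ x in S, ε ^ 2 * (C + K * (G + C) ^ 2) := by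
        rw [setIntegral_const, hR, smul_eq_mul]
        ring
      rw [hFS, hRS, ← integral_const_mul, ← integral_add ((icS _ hcF).const_mul _)
        (icS _ continuous_const)]
      refine setIntegral_mono (intW.sub intU).integrableOn
        (((icS _ hcF).const_mul _).add (icS _ continuous_const)) fun x => ?_
      refine (hK _ _ (huw x)).trans ?_
      have e1 : w x - u x = ‖fderiv ℝ u x‖ * ε + C * ε ^ 2 := by
        simp only [hw]
        ring
      have e2 : ‖fderiv ℝ u x‖ * ε + C * ε ^ 2 ≤ ε * (G + C) := by
        have a1 := mul_le_mul_of_nonneg_right (hG x) hε.le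
        have a2 : C * ε ^ 2 ≤ C * ε := by
          refine mul_le_mul_of_nonneg_left ?_ hC0
          nlinarith
        linarith
      have e3 : (‖fderiv ℝ u x‖ * ε + C * ε ^ 2) ^ 2 ≤ (ε * (G + C)) ^ 2 :=
        pow_le_pow_left₀ (by positivity) e2 2
      have e4 := mul_le_mul_of_nonneg_left e3 hK0
      have e5 : ψ (u x) * (C * ε ^ 2) ≤ 1 * (C * ε ^ 2) :=
        mul_le_mul_of_nonneg_right ψ.le_one (by positivity)
      rw [e1]
      nlinarith
    have : ε * (m * ∫ t, ψ t) ≤ ε * (F + ε * R) := by linarith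
    exact le_of_mul_le_mul_left this hε
  have hlim : Tendsto (fun ε : ℝ => F + ε * R) (𝓝[>] 0) (𝓝 F) := by
    have : Continuous fun ε : ℝ => F + ε * R := by fun_prop
    simpa using (this.tendsto 0).mono_left nhdsWithin_le_nhds
  refine ge_of_tendsto hlim ?_
  have hsmall : ∀ᶠ ε : ℝ in 𝓝[>] 0, C * ε ^ 2 < c - ψ.rOut := by
    have : Continuous fun ε : ℝ => C * ε ^ 2 := by fun_prop
    exact ((this.tendsto 0).mono_left nhdsWithin_le_nhds).eventually
      (gt_mem_nhds (by simpa using hs))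
  have hone : ∀ᶠ ε : ℝ in 𝓝[>] 0, ε < 1 :=
    (gt_mem_nhds (zero_lt_one' ℝ)).filter_mono nhdsWithin_le_nhds
  filter_upwards [hsmall, hone, self_mem_nhdsWithin] with ε h1 h2 h3
  exact main ε h3 h2.le h1.le

lemma norm_sq_eq_sum_sq_single {n : ℕ} (L : Euc n →L[ℝ] ℝ) :
    ‖L‖ ^ 2 = ∑ i, L (EuclideanSpace.single i 1) ^ 2 := by
  set v := (InnerProductSpace.toDual ℝ (Euc n)).symm L with hv
  have h1 : ‖L‖ = ‖v‖ := by simp [hv]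
  rw [h1, EuclideanSpace.norm_sq_eq]
  refine Finset.sum_congr rfl fun i _ => ?_
  have : L (EuclideanSpace.single i 1) = v i := by
    rw [← InnerProductSpace.toDual_symm_apply (𝕜 := ℝ) (y := L), EuclideanSpace.inner_single_right]
    simp [hv]
  rw [this]
  simp

lemma lapl_eq_sum_fderiv {n : ℕ} {u : Euc n → ℝ} (hu : ContDiff ℝ 2 u) (x : Euc n) :
    lapl n u x = ∑ i : Fin n, fderiv ℝ (fun y => fderiv ℝ u y (EuclideanSpace.single i 1)) x
      (EuclideanSpace.single i 1) := by
  refine Finset.sum_congr rfl fun i _ => ?_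
  have hd : DifferentiableAt ℝ (fderiv ℝ u) x :=
    ((hu.fderiv_right (m := 1) (by norm_num)).differentiable one_ne_zero).differentiableAt
  rw [iteratedFDeriv_two_apply, fderiv_clm_apply hd (differentiableAt_const _)]
  simp

lemma continuous_lapl {n : ℕ} {u : Euc n → ℝ} (hu : ContDiff ℝ 2 u) : Continuous (lapl n u) := by
  have := hu.continuous_iteratedFDeriv (m := 2) le_rfl
  unfold lapl
  fun_prop

lemma hasCompactSupport_lapl {n : ℕ} {u : Euc n → ℝ} (hc : HasCompactSupport u) :
    HasCompactSupport (lapl n u) :=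
  (hc.iteratedFDeriv (𝕜 := ℝ) 2).mono' fun x hx => subset_tsupport _ fun h => hx (by
    simp [lapl, h])

/-- The Dirichlet energy of `u` weighted by `ψ(u)` is controlled by the `L¹` norm of `Δu`. -/
theorem integral_mul_norm_fderiv_sq_le {n : ℕ} {u : Euc n → ℝ} (hu : ContDiff ℝ 2 u)
    (hc : HasCompactSupport u) {c : ℝ} (ψ : ContDiffBump c) (hs : ψ.rOut < c) :
    ∫ x, ψ (u x) * ‖fderiv ℝ u x‖ ^ 2 ≤ (∫ t, ψ t) / 2 * ∫ x, |lapl n u x| := by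
  set I := ∫ t, ψ t with hI
  set f : Euc n → ℝ := fun x => bumpPrim ψ (u x) - I / 2 with hf
  have hfc : Continuous f := ((continuous_bumpPrim ψ).comp hu.continuous).sub continuous_const
  have hdu : Differentiable ℝ u := hu.differentiable (by norm_num)
  have hdf : ∀ x, HasFDerivAt f (ψ (u x) • fderiv ℝ u x) x := fun x =>
    ((hasDerivAt_bumpPrim ψ (u x)).comp_hasFDerivAt x (hdu x).hasFDerivAt).sub_const _
  have hcu : Continuous (fderiv ℝ u) := hu.continuous_fderiv (by norm_num)
  have part : ∀ i : Fin n, Integrable (fun x => f x *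
        fderiv ℝ (fun y => fderiv ℝ u y (EuclideanSpace.single i 1)) x
          (EuclideanSpace.single i 1)) ∧
      Integrable (fun x => ψ (u x) * fderiv ℝ u x (EuclideanSpace.single i 1) ^ 2) ∧
      ∫ x, f x * fderiv ℝ (fun y => fderiv ℝ u y (EuclideanSpace.single i 1)) x
        (EuclideanSpace.single i 1) =
      - ∫ x, ψ (u x) * fderiv ℝ u x (EuclideanSpace.single i 1) ^ 2 := by
    intro i
    set e : Euc n := EuclideanSpace.single i 1 with he
    set g : Euc n → ℝ := fun y => fderiv ℝ u y e with hg
    have hgC : ContDiff ℝ 1 g := (hu.fderiv_right (m := 1) (by norm_num)).clm_apply contDiff_const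
    have hgs : HasCompactSupport g := hc.fderiv_apply ℝ e
    have hgc : Continuous g := hgC.continuous
    have hg'c : Continuous fun x => fderiv ℝ g x e :=
      (hgC.continuous_fderiv one_ne_zero).clm_apply continuous_const
    have i1 : Integrable fun x => f x * fderiv ℝ g x e :=
      (hfc.mul hg'c).integrable_of_hasCompactSupport (hgs.fderiv_apply ℝ e).mul_left
    have i2 : Integrable fun x => f x * g x :=
      (hfc.mul hgc).integrable_of_hasCompactSupport hgs.mul_left
    have e1 : (fun x => fderiv ℝ f x e * g x) = fun x => ψ (u x) * g x ^ 2 := by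
      ext x
      rw [(hdf x).fderiv]
      simp only [_root_.smul_apply, smul_eq_mul, hg]
      ring
    have i3 : Integrable fun x => ψ (u x) * g x ^ 2 :=
      ((ψ.continuous.comp hu.continuous).mul (hgc.pow 2)).integrable_of_hasCompactSupport
        (HasCompactSupport.mul_left (by
          simpa only [pow_two] using hgs.mul_left))
    refine ⟨i1, i3, ?_⟩
    have := integral_mul_fderiv_eq_neg_fderiv_mul_of_integrable (μ := (volume : Measure (Euc n)))
      (f := f) (g := g) (v := e) (by rw [e1]; exact i3) i1 i2
      (fun x _ => (hdf x).differentiableAt)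
      (fun x _ => (hgC.differentiable one_ne_zero).differentiableAt)
    rw [this, e1]
  have hL : ∫ x, ψ (u x) * ‖fderiv ℝ u x‖ ^ 2 = -∫ x, f x * lapl n u x := by
    simp only [norm_sq_eq_sum_sq_single, lapl_eq_sum_fderiv hu, Finset.mul_sum]
    rw [integral_finsetSum _ fun i _ => (part i).1, integral_finsetSum _ fun i _ => (part i).2.1,
      ← Finset.sum_neg_distrib]
    refine Finset.sum_congr rfl fun i _ => ?_
    rw [(part i).2.2, neg_neg]
  have hlc := continuous_lapl hu
  have hls := hasCompactSupport_lapl hc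
  rw [hL, ← integral_neg, ← integral_const_mul]
  refine integral_mono ((hfc.mul hlc).integrable_of_hasCompactSupport hls.mul_left).neg
    ((hlc.abs.integrable_of_hasCompactSupport hls.norm).const_mul _) fun x => ?_
  have hfx : |f x| ≤ I / 2 := by
    have h1 := bumpPrim_nonneg ψ hs (u x)
    have h2 := bumpPrim_le_integral ψ (u x)
    rw [abs_le]
    constructor <;> simp only [hf] <;> linarith
  calc -(f x * lapl n u x) ≤ |f x * lapl n u x| := neg_le_abs _
    _ = |f x| * |lapl n u x| := abs_mul _ _
    _ ≤ I / 2 * |lapl n u x| := by gcongr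

lemma sq_integral_mul_le {n : ℕ} {p G : Euc n → ℝ} (hp : ∀ x, 0 ≤ p x)
    (h0 : Integrable p) (h1 : Integrable fun x => p x * G x)
    (h2 : Integrable fun x => p x * G x ^ 2) :
    (∫ x, p x * G x) ^ 2 ≤ (∫ x, p x) * ∫ x, p x * G x ^ 2 := by
  have := discrim_le_zero (a := ∫ x, p x) (b := -2 * ∫ x, p x * G x)
    (c := ∫ x, p x * G x ^ 2) fun t => ?_
  · unfold discrim at this
    nlinarith
  · have e : (∫ x, p x) * (t * t) + -2 * (∫ x, p x * G x) * t + ∫ x, p x * G x ^ 2 =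
        ∫ x, p x * (G x - t) ^ 2 := by
      have : (fun x => p x * (G x - t) ^ 2) =
          fun x => (t * t * p x + -2 * t * (p x * G x)) + p x * G x ^ 2 := by
        ext x
        ring
      have hA : Integrable fun x => t * t * p x + -2 * t * (p x * G x) :=
        (h0.const_mul _).add (h1.const_mul _)
      rw [this, integral_add hA h2,
        integral_add (h0.const_mul _) (h1.const_mul _), integral_const_mul, integral_const_mul]
      ring
    rw [e]
    exact integral_nonneg fun x => mul_nonneg (hp x) (sq_nonneg _)

/-- The discrete differential inequality for the distribution function of `u`. -/
theorem distribFn_sub_ge {n : ℕ} (hn : 2 ≤ n) {u : Euc n → ℝ}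
    (hu : ContDiff ℝ 2 u) (hc : HasCompactSupport u) {s t : ℝ} (hs : 0 < s) (hst : s < t) :
    (isoperimetricConst n * distribFn u t ^ (1 - 1 / (n : ℝ))) ^ 2 * (t - s) ≤
      (∫ x, |lapl n u x|) / 2 * (distribFn u s - distribFn u t) := by
  set b := isoperimetricConst n * distribFn u t ^ (1 - 1 / (n : ℝ)) with hb
  set M := ∫ x, |lapl n u x| with hM
  have hM0 : 0 ≤ M := integral_nonneg fun _ => abs_nonneg _
  have hb0 : 0 ≤ b := mul_nonneg (mul_nonneg (by positivity)
    (Real.rpow_nonneg (unitBallVol_pos n).le _)) (Real.rpow_nonneg (distribFn_nonneg _ _) _)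
  have main : ∀ r : ℝ, 0 < r → r < (t - s) / 2 →
      b ^ 2 * (2 * r) ≤ M / 2 * (distribFn u s - distribFn u t) := by
    intro r hr hr2
    set ψ : ContDiffBump ((s + t) / 2) := ⟨r, (t - s) / 2, hr, hr2⟩ with hψ
    have hout : ψ.rOut = (t - s) / 2 := rfl
    have hsψ : ψ.rOut < (s + t) / 2 := by
      rw [hout]
      linarith
    have h1 := isoperimetric_le_integral_norm_fderiv hn hu hc ψ hsψ
    have h2 := integral_mul_norm_fderiv_sq_le hu hc ψ hsψ
    have ht : (s + t) / 2 + ψ.rOut = t := by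
      rw [hout]
      ring
    rw [ht, ← hb] at h1
    have hI : 2 * r ≤ ∫ x, ψ x := by
      have := ψ.measure_closedBall_le_integral volume
      have e : volume.real (Metric.closedBall ((s + t) / 2) ψ.rIn) = 2 * r := by
        rw [Real.volume_real_closedBall hr.le]
      rwa [e] at this
    set I := ∫ x, ψ x with hIdef
    have hI0 : 0 < I := by linarith
    have hfc : Continuous (fderiv ℝ u) := hu.continuous_fderiv (by norm_num)
    have hpc : Continuous fun x => ψ (u x) := ψ.continuous.comp hu.continuous
    have hp0 : ∀ y ≤ s, ψ y = 0 := fun y hy => ψ.zero_of_le_dist (by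
      rw [hout, dist_comm, Real.dist_eq]
      exact le_trans (by linarith) (le_abs_self _))
    have hp1 : ∀ y, t ≤ y → ψ y = 0 := fun y hy => ψ.zero_of_le_dist (by
      rw [hout, Real.dist_eq]
      exact le_trans (by linarith) (le_abs_self _))
    have hps : HasCompactSupport fun x => ψ (u x) :=
      hc.comp_left (g := ψ) (hp0 0 hs.le)
    have i0 : Integrable fun x => ψ (u x) := hpc.integrable_of_hasCompactSupport hps
    have i1 : Integrable fun x => ψ (u x) * ‖fderiv ℝ u x‖ :=
      (hpc.mul hfc.norm).integrable_of_hasCompactSupport hps.mul_right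
    have i2 : Integrable fun x => ψ (u x) * ‖fderiv ℝ u x‖ ^ 2 :=
      (hpc.mul (hfc.norm.pow 2)).integrable_of_hasCompactSupport hps.mul_right
    have cs := sq_integral_mul_le (p := fun x => ψ (u x)) (G := fun x => ‖fderiv ℝ u x‖)
      (fun _ => ψ.nonneg) i0 i1 i2
    have hP : ∫ x, ψ (u x) ≤ distribFn u s - distribFn u t := by
      have mt : MeasurableSet {x | t < u x} := measurableSet_lt measurable_const
        hu.continuous.measurable
      have ms : MeasurableSet {x | s < u x} := measurableSet_lt measurable_const
        hu.continuous.measurable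
      have hsub : {x | t < u x} ⊆ {x | s < u x} := fun x hx => hst.trans hx
      have e : distribFn u s - distribFn u t = volume.real ({x | s < u x} \ {x | t < u x}) :=
        (measureReal_sdiff hsub mt (volume_superlevel_ne_top hc (by linarith))).symm
      rw [e, ← integral_indicator_one (ms.diff mt)]
      refine integral_mono i0 ?_ fun x => ?_
      · refine (integrable_indicator_iff (ms.diff mt)).2 (integrableOn_const ?_)
        exact ((measure_mono Set.sdiff_subset).trans_lt
          (volume_superlevel_ne_top hc hs.le).lt_top).ne
      · by_cases hx : s < u x
        · by_cases hx' : t < u x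
          · rw [hp1 _ hx'.le]
            exact Set.indicator_nonneg (fun _ _ => zero_le_one) _
          · have hmem : x ∈ {x | s < u x} \ {x | t < u x} := ⟨hx, hx'⟩
            rw [Set.indicator_of_mem hmem]
            exact ψ.le_one
        · rw [hp0 _ (not_lt.1 hx)]
          exact Set.indicator_nonneg (fun _ _ => zero_le_one) _
    have hsq : (b * I) ^ 2 ≤ (distribFn u s - distribFn u t) * (I / 2 * M) := by
      calc (b * I) ^ 2 ≤ (∫ x, ψ (u x) * ‖fderiv ℝ u x‖) ^ 2 :=
            pow_le_pow_left₀ (mul_nonneg hb0 hI0.le) h1 2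
        _ ≤ _ := cs
        _ ≤ _ := mul_le_mul hP h2 (integral_nonneg fun _ => mul_nonneg ψ.nonneg (sq_nonneg _))
          ((integral_nonneg fun _ => ψ.nonneg).trans hP)
    have h3 : I * (b ^ 2 * I) ≤ I * (M / 2 * (distribFn u s - distribFn u t)) := by
      nlinarith
    have h4 := le_of_mul_le_mul_left h3 hI0
    have h5 : b ^ 2 * (2 * r) ≤ b ^ 2 * I := by gcongr
    linarith
  have hlim : Tendsto (fun r : ℝ => b ^ 2 * (2 * r)) (𝓝[<] ((t - s) / 2))
      (𝓝 (b ^ 2 * (2 * ((t - s) / 2)))) := by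
    have : Continuous fun r : ℝ => b ^ 2 * (2 * r) := by fun_prop
    exact (this.tendsto _).mono_left nhdsWithin_le_nhds
  have e : t - s = 2 * ((t - s) / 2) := by ring
  rw [e]
  refine le_of_tendsto hlim ?_
  have hpos : ∀ᶠ r : ℝ in 𝓝[<] ((t - s) / 2), 0 < r :=
    (lt_mem_nhds (by linarith)).filter_mono nhdsWithin_le_nhds
  filter_upwards [hpos, self_mem_nhdsWithin] with r h1 h2
  exact main r h1 h2

lemma mul_rpow_sub_le_rpow_neg_sub {a x y : ℝ} (ha : 0 < a) (hy : 0 < y) (hyx : y ≤ x) :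
    a * x ^ (-(a + 1)) * (x - y) ≤ y ^ (-a) - x ^ (-a) := by
  have hx : 0 < x := hy.trans_le hyx
  have hr : 0 < y / x := by positivity
  have hb : 1 + -a * (y / x - 1) ≤ (y / x) ^ (-a) := by
    rw [Real.rpow_def_of_pos hr]
    have h1 := Real.add_one_le_exp (Real.log (y / x) * -a)
    have h2 := mul_le_mul_of_nonneg_left (Real.log_le_sub_one_of_pos hr) ha.le
    linarith
  have hxa : 0 < x ^ (-a) := Real.rpow_pos_of_pos hx _
  rw [Real.div_rpow hy.le hx.le, le_div_iff₀ hxa] at hb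
  have e2 : x ^ (-(a + 1)) = x ^ (-a) / x := by
    rw [neg_add, ← sub_eq_add_neg, Real.rpow_sub_one hx.ne']
  rw [e2]
  have e3 : a * (x ^ (-a) / x) * (x - y) = (-a * (y / x - 1)) * x ^ (-a) := by
    field_simp
    ring
  linarith

/-- Integration of the differential inequality `-μ' ≥ A μ ^ (a + 1)` in its discrete form. -/
lemma rpow_neg_add_le_of_sub_ge {a A s T : ℝ} {μ : ℝ → ℝ} (ha : 0 < a) (hA : 0 < A) (hsT : s ≤ T)
    (hμ : AntitoneOn μ (Set.Icc s T)) (hT : 0 < μ T)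
    (H : ∀ x ∈ Set.Icc s T, ∀ y ∈ Set.Icc s T, x < y →
      A * μ y ^ (a + 1) * (y - x) ≤ μ x - μ y) :
    μ s ^ (-a) + a * A * (T - s) ≤ μ T ^ (-a) := by
  have hpos : ∀ x ∈ Set.Icc s T, 0 < μ x := fun x hx =>
    hT.trans_le (hμ hx (Set.right_mem_Icc.2 hsT) hx.2)
  have hF : ∀ x ∈ Set.Icc s T, ∀ y ∈ Set.Icc s T, x ≤ y → μ x ^ (-a) ≤ μ y ^ (-a) :=
    fun x hx y hy hxy =>
      Real.rpow_le_rpow_of_nonpos (hpos y hy) (hμ hx hy hxy) (by linarith)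
  have main : ∀ θ : ℝ, 0 < θ → θ < 1 → μ s ^ (-a) + a * A * θ ^ (a + 1) * (T - s) ≤ μ T ^ (-a) := by
    intro θ hθ hθ1
    set c := a * A * θ ^ (a + 1) with hc
    have hc0 : 0 < c := by positivity
    set S := {t ∈ Set.Icc s T | μ s ^ (-a) + c * (t - s) ≤ μ t ^ (-a)} with hS
    have hsS : s ∈ S := ⟨Set.left_mem_Icc.2 hsT, by simp⟩
    have hbd : BddAbove S := ⟨T, fun t ht => ht.1.2⟩
    set t₀ := sSup S with ht₀
    have h0 : t₀ ∈ Set.Icc s T := ⟨le_csSup hbd hsS, csSup_le ⟨s, hsS⟩ fun t ht => ht.1.2⟩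
    have h0S : μ s ^ (-a) + c * (t₀ - s) ≤ μ t₀ ^ (-a) := by
      have : t₀ ≤ s + (μ t₀ ^ (-a) - μ s ^ (-a)) / c := by
        refine csSup_le ⟨s, hsS⟩ fun t ht => ?_
        have h1 := ht.2.trans (hF t ht.1 t₀ h0 (le_csSup hbd ht))
        rw [← sub_le_iff_le_add', le_div_iff₀ hc0]
        linarith
      rw [← sub_le_iff_le_add', le_div_iff₀ hc0] at this
      linarith
    rcases h0.2.eq_or_lt with h | h
    · rwa [h] at h0S
    · exfalso
      have step : ∃ y, t₀ < y ∧ y ≤ T ∧ μ t₀ ^ (-a) + c * (y - t₀) ≤ μ y ^ (-a) := by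
        by_cases hy : ∃ y, t₀ < y ∧ y ≤ T ∧ θ * μ t₀ ≤ μ y
        · obtain ⟨y, hy1, hy2, hy3⟩ := hy
          have hyI : y ∈ Set.Icc s T := ⟨h0.1.trans hy1.le, hy2⟩
          refine ⟨y, hy1, hy2, ?_⟩
          have h1 := H t₀ h0 y hyI hy1
          have h2 := mul_rpow_sub_le_rpow_neg_sub ha (hpos y hyI) (hμ h0 hyI hy1.le)
          have h3 : (θ * μ t₀) ^ (a + 1) ≤ μ y ^ (a + 1) :=
            Real.rpow_le_rpow (mul_nonneg hθ.le (hpos _ h0).le) hy3 (by linarith)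
          rw [Real.mul_rpow hθ.le (hpos _ h0).le] at h3
          have e1 : μ t₀ ^ (a + 1) * μ t₀ ^ (-(a + 1)) = 1 := by
            rw [← Real.rpow_add (hpos _ h0)]
            simp
          have hm : 0 < μ t₀ ^ (-(a + 1)) := Real.rpow_pos_of_pos (hpos _ h0) _
          have h4 : c * (y - t₀) ≤ a * μ t₀ ^ (-(a + 1)) * (μ t₀ - μ y) := by
            calc c * (y - t₀) = a * (μ t₀ ^ (-(a + 1))) *
                  (A * (θ ^ (a + 1) * μ t₀ ^ (a + 1)) * (y - t₀)) := by
                  rw [hc]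
                  linear_combination (-(a * A * θ ^ (a + 1) * (y - t₀))) * e1
              _ ≤ a * (μ t₀ ^ (-(a + 1))) * (A * μ y ^ (a + 1) * (y - t₀)) := by
                  have : 0 ≤ y - t₀ := by linarith
                  gcongr
              _ ≤ _ := by gcongr
          linarith
        · push Not at hy
          set δ := (θ * μ t₀) ^ (-a) - μ t₀ ^ (-a) with hδ
          have hδ0 : 0 < δ := sub_pos.2 (Real.rpow_lt_rpow_of_neg
            (mul_pos hθ (hpos _ h0)) (by nlinarith [hpos _ h0]) (by linarith))
          refine ⟨min T (t₀ + δ / c), lt_min h (by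
            have : 0 < δ / c := by positivity
            linarith), min_le_left _ _, ?_⟩
          set y := min T (t₀ + δ / c) with hyd
          have hy1 : t₀ < y := lt_min h (by
            have : 0 < δ / c := by positivity
            linarith)
          have hyI : y ∈ Set.Icc s T := ⟨h0.1.trans hy1.le, min_le_left _ _⟩
          have h1 : y - t₀ ≤ δ / c := by
            have := min_le_right T (t₀ + δ / c)
            linarith
          rw [le_div_iff₀ hc0] at h1
          have h2 : (θ * μ t₀) ^ (-a) ≤ μ y ^ (-a) :=
            Real.rpow_le_rpow_of_nonpos (hpos _ hyI) (hy y hy1 hyI.2).le (by linarith)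
          linarith
      obtain ⟨y, hy1, hy2, hy3⟩ := step
      have : y ∈ S := ⟨⟨h0.1.trans hy1.le, hy2⟩, by linarith⟩
      exact absurd (le_csSup hbd this) (not_le.2 hy1)
  have hlim : Tendsto (fun θ : ℝ => μ s ^ (-a) + a * A * θ ^ (a + 1) * (T - s)) (𝓝[<] 1)
      (𝓝 (μ s ^ (-a) + a * A * 1 ^ (a + 1) * (T - s))) := by
    have : Continuous fun θ : ℝ => μ s ^ (-a) + a * A * θ ^ (a + 1) * (T - s) := by
      have := Real.continuous_rpow_const (q := a + 1) (by linarith)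
      fun_prop
    exact (this.tendsto _).mono_left nhdsWithin_le_nhds
  rw [Real.one_rpow, mul_one] at hlim
  refine le_of_tendsto hlim ?_
  have h0 : ∀ᶠ θ : ℝ in 𝓝[<] 1, 0 < θ :=
    (lt_mem_nhds zero_lt_one).filter_mono nhdsWithin_le_nhds
  filter_upwards [h0, self_mem_nhdsWithin] with θ h1 h2
  exact main θ h1 h2

/-- The pointwise rearrangement bound on the distribution function. -/
theorem distribFn_le {n : ℕ} (hn : 3 ≤ n) {u : Euc n → ℝ} (hu : ContDiff ℝ 2 u)
    (hc : HasCompactSupport u) {m a A V t : ℝ} (ha : a = ((n : ℝ) - 2) / n) (hm : 0 < m)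
    (hM : ∫ x, |lapl n u x| ≤ 2 * m) (hA : A = a * (isoperimetricConst n ^ 2 / m))
    (hV : 0 < V) (huV : distribFn u 0 ≤ V) (ht : 0 < t) :
    distribFn u t ≤ (V ^ (-a) + A * t) ^ (-(1 / a)) := by
  have hn' : (3 : ℝ) ≤ n := by exact_mod_cast hn
  have ha0 : 0 < a := by
    rw [ha]
    exact div_pos (by linarith) (by linarith)
  have hiso : 0 < isoperimetricConst n :=
    mul_pos (by linarith) (Real.rpow_pos_of_pos (unitBallVol_pos n) _)
  have hA0 : 0 < A := by
    rw [hA]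
    positivity
  have hVa : 0 < V ^ (-a) := Real.rpow_pos_of_pos hV _
  rcases (distribFn_nonneg u t).eq_or_lt with h0 | h0
  · rw [← h0]
    positivity
  have main : ∀ s ∈ Set.Ioo 0 t, V ^ (-a) + A * (t - s) ≤ distribFn u t ^ (-a) := by
    intro s hs
    have h := rpow_neg_add_le_of_sub_ge (μ := distribFn u) (A := isoperimetricConst n ^ 2 / m)
      (s := s) (T := t) ha0 (by positivity) hs.2.le
      (fun x hx y _ hxy => distribFn_anti hc (hs.1.le.trans hx.1) hxy) h0 fun x hx y _ hxy => ?_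
    · refine le_trans ?_ h
      rw [← hA]
      refine add_le_add_left (Real.rpow_le_rpow_of_nonpos ?_
        ((distribFn_anti hc le_rfl hs.1.le).trans huV)
        (by linarith)) _
      exact h0.trans_le (distribFn_anti hc hs.1.le hs.2.le)
    · have h1 := distribFn_sub_ge (by omega) hu hc (hs.1.trans_le hx.1) hxy
      have e : a + 1 = (1 - 1 / (n : ℝ)) * 2 := by
        rw [ha]
        field_simp
        ring
      have h2 : (isoperimetricConst n * distribFn u y ^ (1 - 1 / (n : ℝ))) ^ 2 =
          isoperimetricConst n ^ 2 * distribFn u y ^ (a + 1) := by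
        rw [mul_pow, e, Real.rpow_mul (distribFn_nonneg _ _), Real.rpow_two]
      rw [h2] at h1
      have h3 : (∫ x, |lapl n u x|) / 2 * (distribFn u x - distribFn u y) ≤
          m * (distribFn u x - distribFn u y) := by
        refine mul_le_mul_of_nonneg_right (by linarith) (sub_nonneg.2 ?_)
        exact distribFn_anti hc (hs.1.le.trans hx.1) hxy.le
      have h4 := h1.trans h3
      rw [div_mul_eq_mul_div, div_mul_eq_mul_div, div_le_iff₀ hm]
      linarith
  have lim : V ^ (-a) + A * t ≤ distribFn u t ^ (-a) := by
    have hlim : Tendsto (fun s : ℝ => V ^ (-a) + A * (t - s)) (𝓝[>] 0)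
        (𝓝 (V ^ (-a) + A * (t - 0))) := by
      have : Continuous fun s : ℝ => V ^ (-a) + A * (t - s) := by fun_prop
      exact (this.tendsto _).mono_left nhdsWithin_le_nhds
    rw [sub_zero] at hlim
    refine le_of_tendsto hlim ?_
    have hlt : ∀ᶠ s : ℝ in 𝓝[>] 0, s < t := (gt_mem_nhds ht).filter_mono nhdsWithin_le_nhds
    filter_upwards [hlt, self_mem_nhdsWithin] with s h1 h2
    exact main s ⟨h2, h1⟩
  have h5 := Real.rpow_le_rpow_of_nonpos (z := -(1 / a)) (by positivity) lim (by
    have : 0 < 1 / a := by positivity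
    linarith)
  refine le_trans (le_of_eq ?_) h5
  rw [← Real.rpow_mul h0.le]
  have : -a * -(1 / a) = 1 := by field_simp
  rw [this, Real.rpow_one]

lemma lintegral_rpow_mul_exp_neg_mul_Ioi {a r : ℝ} (ha : 0 < a) (hr : 0 < r) :
    ∫⁻ t in Set.Ioi (0 : ℝ), ENNReal.ofReal (t ^ (a - 1) * Real.exp (-(r * t))) =
      ENNReal.ofReal (r ^ (-a) * Real.Gamma a) := by
  have h := Real.integral_rpow_mul_exp_neg_mul_Ioi ha hr
  have h0 : 0 < r ^ (-a) * Real.Gamma a :=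
    mul_pos (Real.rpow_pos_of_pos hr _) (Real.Gamma_pos_of_pos ha)
  rw [one_div, Real.inv_rpow hr.le, ← Real.rpow_neg hr.le] at h
  rw [← h, ofReal_integral_eq_lintegral_ofReal]
  · by_contra hi
    rw [integral_undef hi] at h
    exact h0.ne h
  · filter_upwards [ae_restrict_mem measurableSet_Ioi] with t ht
    exact mul_nonneg (Real.rpow_nonneg (le_of_lt ht) _) (Real.exp_nonneg _)

/-- An affine change of variables of Euler's beta integral on the half line. -/
lemma lintegral_rpow_mul_add_mul_rpow_neg {q b p A : ℝ} (hq : 0 < q) (hqb : q < b) (hp : 0 < p)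
    (hA : 0 < A) :
    ∫⁻ t in Set.Ioi (0 : ℝ), ENNReal.ofReal ((p + A * t) ^ (-b)) * ENNReal.ofReal (t ^ (q - 1)) =
      ENNReal.ofReal (A ^ (-q) * p ^ (q - b) *
        (Real.Gamma q * Real.Gamma (b - q) / Real.Gamma b)) := by
  have hb : 0 < Real.Gamma b := Real.Gamma_pos_of_pos (hq.trans hqb)
  have hbE : ENNReal.ofReal (Real.Gamma b) ≠ 0 := by simpa using hb
  rw [← ENNReal.mul_right_inj hbE ENNReal.ofReal_ne_top, ← lintegral_const_mul _ (by fun_prop)]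
  have e1 : ∫⁻ t in Set.Ioi (0 : ℝ), ENNReal.ofReal (Real.Gamma b) *
      (ENNReal.ofReal ((p + A * t) ^ (-b)) * ENNReal.ofReal (t ^ (q - 1))) =
      ∫⁻ t in Set.Ioi (0 : ℝ), ∫⁻ y in Set.Ioi (0 : ℝ),
        ENNReal.ofReal (y ^ (b - 1) * Real.exp (-((p + A * t) * y))) *
          ENNReal.ofReal (t ^ (q - 1)) := by
    refine setLIntegral_congr_fun measurableSet_Ioi fun t ht => ?_
    have ht0 : 0 < t := ht
    have hpt : 0 < p + A * t := by positivity
    rw [lintegral_mul_const _ (by fun_prop),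
      lintegral_rpow_mul_exp_neg_mul_Ioi (hq.trans hqb) hpt, ← mul_assoc,
      ← ENNReal.ofReal_mul hb.le, mul_comm (Real.Gamma b)]
  rw [e1, lintegral_lintegral_swap (by fun_prop)]
  have e2 : ∫⁻ y in Set.Ioi (0 : ℝ), ∫⁻ t in Set.Ioi (0 : ℝ),
        ENNReal.ofReal (y ^ (b - 1) * Real.exp (-((p + A * t) * y))) *
          ENNReal.ofReal (t ^ (q - 1)) =
      ∫⁻ y in Set.Ioi (0 : ℝ), ENNReal.ofReal (A ^ (-q) * Real.Gamma q) *
        ENNReal.ofReal (y ^ (b - q - 1) * Real.exp (-(p * y))) := by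
    refine setLIntegral_congr_fun measurableSet_Ioi fun y hy => ?_
    have hy0 : 0 < y := hy
    have e3 : ∀ t, ENNReal.ofReal (y ^ (b - 1) * Real.exp (-((p + A * t) * y))) *
        ENNReal.ofReal (t ^ (q - 1)) = ENNReal.ofReal (y ^ (b - 1) * Real.exp (-(p * y))) *
          ENNReal.ofReal (t ^ (q - 1) * Real.exp (-((A * y) * t))) := by
      intro t
      rw [← ENNReal.ofReal_mul (by positivity), ← ENNReal.ofReal_mul (by positivity)]
      have : Real.exp (-((p + A * t) * y)) = Real.exp (-(p * y)) * Real.exp (-((A * y) * t)) := by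
        rw [← Real.exp_add]
        congr 1
        ring
      rw [this]
      congr 1
      ring
    simp only [e3]
    rw [lintegral_const_mul _ (by fun_prop),
      lintegral_rpow_mul_exp_neg_mul_Ioi hq (mul_pos hA hy0), ← ENNReal.ofReal_mul (by positivity),
      ← ENNReal.ofReal_mul (mul_nonneg (Real.rpow_nonneg hA.le _) (Real.Gamma_pos_of_pos hq).le),
      Real.mul_rpow hA.le hy0.le]
    have : y ^ (b - q - 1) = y ^ (b - 1) * y ^ (-q) := by
      rw [← Real.rpow_add hy0]
      congr 1
      ring
    rw [this]
    congr 1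
    ring
  rw [e2, lintegral_const_mul _ (by fun_prop),
    lintegral_rpow_mul_exp_neg_mul_Ioi (sub_pos.2 hqb) hp,
    ← ENNReal.ofReal_mul (mul_nonneg (Real.rpow_nonneg hA.le _) (Real.Gamma_pos_of_pos hq).le),
    ← ENNReal.ofReal_mul hb.le, neg_sub]
  congr 1
  field_simp

/-- The sharp `L^q` bound for the positive part of `u`. -/
theorem lintegral_posPart_rpow_le {n : ℕ} (hn : 3 ≤ n) {u : Euc n → ℝ} (hu : ContDiff ℝ 2 u)
    (hc : HasCompactSupport u) {m a A V q : ℝ} (ha : a = ((n : ℝ) - 2) / n) (hm : 0 < m)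
    (hM : ∫ x, |lapl n u x| ≤ 2 * m) (hA : A = a * (isoperimetricConst n ^ 2 / m))
    (hV : 0 < V) (huV : distribFn u 0 ≤ V) (hq : 0 < q) (hqa : q < 1 / a) :
    ∫⁻ x, ENNReal.ofReal (max (u x) 0 ^ q) ≤ ENNReal.ofReal (A ^ (-q) * V ^ (1 - a * q) *
      (Real.Gamma (1 / a - q) * Real.Gamma (q + 1) / Real.Gamma (1 / a))) := by
  have hn' : (3 : ℝ) ≤ n := by exact_mod_cast hn
  have ha0 : 0 < a := by
    rw [ha]
    exact div_pos (by linarith) (by linarith)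
  have hiso : 0 < isoperimetricConst n :=
    mul_pos (by linarith) (Real.rpow_pos_of_pos (unitBallVol_pos n) _)
  have hA0 : 0 < A := by
    rw [hA]
    positivity
  have hVa : 0 < V ^ (-a) := Real.rpow_pos_of_pos hV _
  rw [lintegral_rpow_eq_lintegral_meas_lt_mul volume (f := fun x => max (u x) 0)
    (ae_of_all _ fun x => le_max_right _ _)
    (hu.continuous.measurable.max measurable_const).aemeasurable hq]
  have h1 : ∫⁻ t in Set.Ioi 0, volume {x | t < max (u x) 0} * ENNReal.ofReal (t ^ (q - 1)) ≤
      ∫⁻ t in Set.Ioi 0, ENNReal.ofReal ((V ^ (-a) + A * t) ^ (-(1 / a))) *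
        ENNReal.ofReal (t ^ (q - 1)) := by
    refine setLIntegral_mono' measurableSet_Ioi fun t ht => ?_
    have e : {x | t < max (u x) 0} = {x | t < u x} := by
      ext x
      simp [not_lt.2 (le_of_lt (Set.mem_Ioi.1 ht))]
    rw [e]
    gcongr
    rw [← ENNReal.ofReal_toReal (volume_superlevel_ne_top hc (le_of_lt ht))]
    exact ENNReal.ofReal_le_ofReal (distribFn_le hn hu hc ha hm hM hA hV huV ht)
  rw [lintegral_rpow_mul_add_mul_rpow_neg hq hqa hVa hA0] at h1
  refine (mul_le_mul_right h1 _).trans (le_of_eq ?_)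
  rw [← ENNReal.ofReal_mul hq.le, Real.Gamma_add_one hq.ne', ← Real.rpow_mul hV.le]
  have : -a * (q - 1 / a) = 1 - a * q := by
    field_simp
    ring
  rw [this]
  congr 1
  ring

lemma rpow_add_rpow_le_two_rpow_mul {x y p : ℝ} (hx : 0 ≤ x) (hy : 0 ≤ y) (hp : 0 ≤ p)
    (hp1 : p ≤ 1) : x ^ p + y ^ p ≤ 2 ^ (1 - p) * (x + y) ^ p := by
  have h := (Real.concaveOn_rpow hp hp1).2 (Set.mem_Ici.2 hx) (Set.mem_Ici.2 hy)
    (by norm_num : (0 : ℝ) ≤ 1 / 2) (by norm_num : (0 : ℝ) ≤ 1 / 2) (by norm_num)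
  simp only [smul_eq_mul] at h
  rw [← mul_add, ← mul_add, Real.mul_rpow (by norm_num) (add_nonneg hx hy)] at h
  have e : (2 : ℝ) ^ (1 - p) = 2 * (1 / 2) ^ p := by
    rw [Real.rpow_sub two_pos, Real.rpow_one, Real.div_rpow zero_le_one two_pos.le, Real.one_rpow]
    ring
  rw [e]
  linarith

/-- The `L^q` bound for test functions. -/
theorem lintegral_abs_rpow_le {n : ℕ} (hn : 3 ≤ n) {Ω : Set (Euc n)} (hΩ : volume Ω ≠ ∞)
    {u : Euc n → ℝ} (hu : ContDiff ℝ 2 u) (hc : HasCompactSupport u) (hs : tsupport u ⊆ Ω)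
    {m a A W q : ℝ} (ha : a = ((n : ℝ) - 2) / n) (hm : 0 < m)
    (hM : ∫ x, |lapl n u x| ≤ 2 * m) (hA : A = a * (isoperimetricConst n ^ 2 / m))
    (hW : (volume Ω).toReal < W) (hq : 0 < q) (hqa : q < 1 / a) :
    ∫⁻ x, ENNReal.ofReal (|u x| ^ q) ≤
      ENNReal.ofReal (A ^ (-q) * (2 ^ (a * q) * W ^ (1 - a * q)) *
        (Real.Gamma (1 / a - q) * Real.Gamma (q + 1) / Real.Gamma (1 / a))) := by
  have hn' : (3 : ℝ) ≤ n := by exact_mod_cast hn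
  have ha0 : 0 < a := by
    rw [ha]
    exact div_pos (by linarith) (by linarith)
  have hiso : 0 < isoperimetricConst n :=
    mul_pos (by linarith) (Real.rpow_pos_of_pos (unitBallVol_pos n) _)
  have hA0 : 0 < A := by
    rw [hA]
    positivity
  have haq : a * q < 1 := by
    rw [lt_div_iff₀ ha0] at hqa
    linarith
  set G := Real.Gamma (1 / a - q) * Real.Gamma (q + 1) / Real.Gamma (1 / a) with hG
  have hG0 : 0 ≤ G := by
    have h1 := Real.Gamma_pos_of_pos (sub_pos.2 hqa)
    have h2 := Real.Gamma_pos_of_pos (by linarith : 0 < q + 1)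
    have h3 := Real.Gamma_pos_of_pos (hq.trans hqa)
    positivity
  have hun : ContDiff ℝ 2 fun x => -u x := hu.neg
  have hcn : HasCompactSupport fun x => -u x := hc.neg
  have hMn : ∫ x, |lapl n (fun x => -u x) x| ≤ 2 * m := by
    have : ∀ x, lapl n (fun x => -u x) x = -lapl n u x := fun x => by
      have h : (fun x => -u x) = -u := rfl
      simp [lapl, h, iteratedFDeriv_neg_apply]
    simpa only [this, abs_neg] using hM
  have hsum : distribFn u 0 + distribFn (fun x => -u x) 0 ≤ (volume Ω).toReal := by
    have hdis : Disjoint {x | 0 < u x} {x | 0 < -u x} :=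
      Set.disjoint_left.2 fun x hx hx' => by
        simp only [Set.mem_ofPred_eq] at hx hx'
        linarith
    have hmeas : MeasurableSet {x | 0 < -u x} :=
      measurableSet_lt measurable_const hun.continuous.measurable
    rw [distribFn, distribFn, ← ENNReal.toReal_add (volume_superlevel_ne_top hc le_rfl)
      (volume_superlevel_ne_top hcn le_rfl), ← measure_union hdis hmeas]
    refine ENNReal.toReal_mono hΩ (measure_mono fun x hx => hs (subset_tsupport u ?_))
    rcases hx with hx | hx
    · rw [Set.mem_ofPred_eq] at hx
      exact hx.ne'
    · rw [Set.mem_ofPred_eq] at hx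
      exact (neg_pos.1 hx).ne
  set δ := (W - distribFn u 0 - distribFn (fun x => -u x) 0) / 2 with hδ
  have hδ0 : 0 < δ := by
    rw [hδ]
    linarith
  have h1 := lintegral_posPart_rpow_le hn hu hc ha hm hM hA
    (V := distribFn u 0 + δ) (by linarith [distribFn_nonneg u 0]) (by linarith) hq hqa
  have h2 := lintegral_posPart_rpow_le hn hun hcn ha hm hMn hA
    (V := distribFn (fun x => -u x) 0 + δ)
    (by linarith [distribFn_nonneg (fun x => -u x) 0]) (by linarith) hq hqa
  rw [← hG] at h1 h2
  have hp := rpow_add_rpow_le_two_rpow_mul (p := 1 - a * q) (x := distribFn u 0 + δ)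
    (y := distribFn (fun x => -u x) 0 + δ) (by linarith [distribFn_nonneg u 0])
    (by linarith [distribFn_nonneg (fun x => -u x) 0]) (by linarith)
    (by linarith [mul_pos ha0 hq])
  have e1 : distribFn u 0 + δ + (distribFn (fun x => -u x) 0 + δ) = W := by
    rw [hδ]
    ring
  rw [e1, sub_sub_cancel] at hp
  have hsplit : ∀ x, ENNReal.ofReal (|u x| ^ q) =
      ENNReal.ofReal (max (u x) 0 ^ q) + ENNReal.ofReal (max (-u x) 0 ^ q) := by
    intro x
    rcases le_total 0 (u x) with h | h
    · rw [max_eq_left h, max_eq_right (by linarith), abs_of_nonneg h, Real.zero_rpow hq.ne']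
      simp
    · rw [max_eq_right h, max_eq_left (by linarith), abs_of_nonpos h, Real.zero_rpow hq.ne']
      simp
  have hmeasu : Measurable fun x => ENNReal.ofReal (max (u x) 0 ^ q) := by
    have := hu.continuous.measurable
    fun_prop
  simp only [hsplit]
  rw [lintegral_add_left hmeasu]
  refine (add_le_add h1 h2).trans ?_
  have hAq : 0 < A ^ (-q) := Real.rpow_pos_of_pos hA0 _
  have pos : ∀ V : ℝ, 0 < V → 0 ≤ A ^ (-q) * V ^ (1 - a * q) * G := fun V hV => by positivity
  rw [← ENNReal.ofReal_add (pos _ (by linarith [distribFn_nonneg u 0]))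
    (pos _ (by linarith [distribFn_nonneg (fun x => -u x) 0]))]
  refine ENNReal.ofReal_le_ofReal ?_
  rw [← add_mul, ← mul_add]
  gcongr

lemma IsTestFun.contDiff_two {n : ℕ} {Ω : Set (Euc n)} {φ : Euc n → ℝ} (h : IsTestFun n Ω φ) :
    ContDiff ℝ 2 φ :=
  contDiff_infty.1 h.1 2

lemma omegaS_eq_mul_unitBallVol {n : ℕ} (hn : n ≠ 0) : omegaS n = n * unitBallVol n := by
  have hn0 : (0 : ℝ) < n := by positivity
  have hG : 0 < Real.Gamma ((n : ℝ) / 2) := Real.Gamma_pos_of_pos (by positivity)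
  have : Nonempty (Fin n) := ⟨⟨0, Nat.pos_of_ne_zero hn⟩⟩
  rw [unitBallVol, EuclideanSpace.volume_ball, Fintype.card_fin, ENNReal.ofReal_one, one_pow,
    one_mul, Real.Gamma_add_one (by positivity), ENNReal.toReal_ofReal (by positivity), omegaS,
    Real.sqrt_eq_rpow, ← Real.rpow_natCast, ← Real.rpow_mul Real.pi_pos.le]
  have : (1 / 2 : ℝ) * n = n / 2 := by ring
  rw [this]
  field_simp

lemma mul_isoperimetricConst_sq_mul_cConst {n : ℕ} (hn : 3 ≤ n) :
    ((n : ℝ) - 2) / n * isoperimetricConst n ^ 2 *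
      (cConst n * (omegaS n / n) ^ (((n : ℝ) - 2) / n)) = 1 := by
  have hn' : (3 : ℝ) ≤ n := by exact_mod_cast hn
  have hn2 : (n : ℝ) - 2 ≠ 0 := by linarith
  have hn0 : (n : ℝ) ≠ 0 := by linarith
  have hκ := unitBallVol_pos n
  have e1 : omegaS n / n = unitBallVol n := by
    rw [omegaS_eq_mul_unitBallVol (by omega), mul_div_cancel_left₀ _ hn0]
  have e2 : isoperimetricConst n ^ 2 = (n : ℝ) ^ 2 * unitBallVol n ^ (2 / (n : ℝ)) := by
    rw [isoperimetricConst, mul_pow, ← Real.rpow_natCast (unitBallVol n ^ _), ← Real.rpow_mul hκ.le]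
    congr 2
    push_cast
    ring
  have e3 : unitBallVol n ^ (2 / (n : ℝ)) * unitBallVol n ^ (((n : ℝ) - 2) / n) =
      unitBallVol n := by
    rw [← Real.rpow_add hκ, ← add_div, add_sub_cancel, div_self hn0, Real.rpow_one]
  rw [e1, e2, cConst, omegaS_eq_mul_unitBallVol (by omega)]
  field_simp
  rw [e3]

/-- The `L^q` bound on `W^{2,1}_{Δ,0}(Ω)`. -/
theorem MemW21Delta0.integral_abs_rpow_le {n : ℕ} (hn : 3 ≤ n) {Ω : Set (Euc n)}
    (hΩ : volume Ω ≠ ∞) {u f : Euc n → ℝ} (hu : MemW21Delta0 n Ω u f) {m a A W q : ℝ}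
    (ha : a = ((n : ℝ) - 2) / n) (hm : 0 < m) (hM : L1norm n Ω f < 2 * m)
    (hA : A = a * (isoperimetricConst n ^ 2 / m)) (hW : (volume Ω).toReal < W) (hq : 0 < q)
    (hqa : q < 1 / a) :
    ∫ x in Ω, |u x| ^ q ≤ A ^ (-q) * (2 ^ (a * q) * W ^ (1 - a * q)) *
        (Real.Gamma (1 / a - q) * Real.Gamma (q + 1) / Real.Gamma (1 / a)) := by
  obtain ⟨hui, hfi, φ, hφ, hφu, hφf⟩ := hu
  set C := A ^ (-q) * (2 ^ (a * q) * W ^ (1 - a * q)) *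
    (Real.Gamma (1 / a - q) * Real.Gamma (q + 1) / Real.Gamma (1 / a)) with hC
  have hn' : (3 : ℝ) ≤ n := by exact_mod_cast hn
  have ha0 : 0 < a := by
    rw [ha]
    exact div_pos (by linarith) (by linarith)
  have hiso : 0 < isoperimetricConst n :=
    mul_pos (by linarith) (Real.rpow_pos_of_pos (unitBallVol_pos n) _)
  have hA0 : 0 < A := by
    rw [hA]
    positivity
  have hW0 : 0 < W := ENNReal.toReal_nonneg.trans_lt hW
  have hC0 : 0 ≤ C := by
    have h1 := Real.Gamma_pos_of_pos (sub_pos.2 hqa)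
    have h2 := Real.Gamma_pos_of_pos (by linarith : 0 < q + 1)
    have h3 := Real.Gamma_pos_of_pos (hq.trans hqa)
    positivity
  have hcont : ∀ k, Continuous (φ k) := fun k => (hφ k).1.continuous
  have hlap : ∀ k, Integrable (lapl n (φ k)) := fun k =>
    (continuous_lapl (hφ k).contDiff_two).integrable_of_hasCompactSupport
      (hasCompactSupport_lapl (hφ k).2.1)
  have hlapΩ : ∀ k, ∫ x, |lapl n (φ k) x| = ∫ x in Ω, |lapl n (φ k) x| := fun k => by
    refine (setIntegral_eq_integral_of_forall_compl_eq_zero fun x hx => ?_).symm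
    have h : iteratedFDeriv ℝ 2 (φ k) x = 0 := by
      by_contra h
      exact hx ((hφ k).2.2 (support_iteratedFDeriv_subset 2 h))
    simp [lapl, h]
  have hev : ∀ᶠ k in atTop, ∫ x, |lapl n (φ k) x| ≤ 2 * m := by
    have := hφf.eventually (gt_mem_nhds (sub_pos.2 hM))
    filter_upwards [this] with k hk
    have hd : IntegrableOn (fun x => |lapl n (φ k) x - f x|) Ω :=
      ((hlap k).integrableOn.sub hfi).abs
    have hle : ∫ x in Ω, |lapl n (φ k) x| ≤
        ∫ x in Ω, (|lapl n (φ k) x - f x| + |f x|) := by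
      refine integral_mono (hlap k).integrableOn.abs
        (hd.add hfi.abs) fun x => ?_
      have := abs_add_le (lapl n (φ k) x - f x) (f x)
      rwa [sub_add_cancel] at this
    rw [integral_add hd hfi.abs] at hle
    rw [hlapΩ]
    rw [L1norm] at hk
    linarith
  have hae : ∃ ns : ℕ → ℕ, StrictMono ns ∧
      ∀ᵐ x ∂volume.restrict Ω, Tendsto (fun i => φ (ns i) x) atTop (𝓝 (u x)) := by
    refine TendstoInMeasure.exists_seq_tendsto_ae (tendstoInMeasure_of_tendsto_eLpNorm one_ne_zero
      (fun k => (hcont k).aestronglyMeasurable) hui.aestronglyMeasurable ?_)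
    have e : ∀ k, eLpNorm (φ k - u) 1 (volume.restrict Ω) =
        ENNReal.ofReal (∫ x in Ω, |φ k x - u x|) := fun k => by
      have hi : Integrable (φ k - u) (volume.restrict Ω) :=
        ((hcont k).integrable_of_hasCompactSupport (hφ k).2.1).integrableOn.sub hui
      rw [eLpNorm_one_eq_lintegral_enorm, ← ofReal_integral_norm_eq_lintegral_enorm hi]
      rfl
    simp only [e]
    simpa using ENNReal.tendsto_ofReal hφu
  obtain ⟨ns, hns, hlim⟩ := hae
  have hfatou : ∫⁻ x in Ω, ENNReal.ofReal (|u x| ^ q) ≤ ENNReal.ofReal C := by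
    calc ∫⁻ x in Ω, ENNReal.ofReal (|u x| ^ q)
        = ∫⁻ x in Ω, liminf (fun i => ENNReal.ofReal (|φ (ns i) x| ^ q)) atTop := by
          refine lintegral_congr_ae ?_
          filter_upwards [hlim] with x hx
          exact (ENNReal.tendsto_ofReal
            ((Real.continuousAt_rpow_const _ _ (Or.inr hq.le)).tendsto.comp hx.abs)).liminf_eq.symm
      _ ≤ liminf (fun i => ∫⁻ x in Ω, ENNReal.ofReal (|φ (ns i) x| ^ q)) atTop := by
          refine lintegral_liminf_le fun i => ?_
          have := (hcont (ns i)).measurable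
          fun_prop
      _ ≤ ENNReal.ofReal C := by
          refine liminf_le_of_frequently_le' (Eventually.frequently ?_)
          filter_upwards [hns.tendsto_atTop.eventually hev] with i hi
          exact (setLIntegral_le_lintegral _ _).trans (lintegral_abs_rpow_le hn hΩ
            (hφ _).contDiff_two (hφ _).2.1 (hφ _).2.2 ha hm hi hA hW hq hqa)
  have hmeas : AEStronglyMeasurable (fun x => |u x| ^ q) (volume.restrict Ω) :=
    (hui.aestronglyMeasurable.aemeasurable.abs.pow_const q).aestronglyMeasurable
  rw [integral_eq_lintegral_of_nonneg_ae (ae_of_all _ fun x => by positivity) hmeas]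
  exact ENNReal.toReal_le_of_le_ofReal hC0 hfatou

/-- For Ω ⊆ ℝⁿ (n ≥ 3) open and bounded and 1 ≤ q < n/(n-2), every
u ∈ W^{2,1}_{Δ,0}(Ω) satisfies
‖u‖_q ≤ 2^{-2/(qn)} c_n (ω_{n-1}/n)^{(n-2)/n} [Γ(n/(n-2)-q)Γ(q+1)/Γ(n/(n-2))]^{1/q}
|Ω|^{1/q-(n-2)/n} ‖Δu‖₁. -/
theorem stmt_16 (n : ℕ) (hn : 3 ≤ n) (Ω : Set (Euc n)) (hΩo : IsOpen Ω)
    (hΩb : Bornology.IsBounded Ω) (q : ℝ) (hq1 : 1 ≤ q)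
    (hq2 : q < (n : ℝ) / ((n : ℝ) - 2))
    (u f : Euc n → ℝ) (hu : MemW21Delta0 n Ω u f) :
    (∫ x in Ω, |u x| ^ q) ^ (1 / q) ≤
      (2 : ℝ) ^ (-(2 / (q * (n : ℝ)))) *
        cConst n * (omegaS n / (n : ℝ)) ^ (((n : ℝ) - 2) / (n : ℝ)) *
        (Real.Gamma ((n : ℝ) / ((n : ℝ) - 2) - q) * Real.Gamma (q + 1) /
          Real.Gamma ((n : ℝ) / ((n : ℝ) - 2))) ^ (1 / q) *
        (volume Ω).toReal ^ (1 / q - ((n : ℝ) - 2) / (n : ℝ)) * L1norm n Ω f := by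
  have hn' : (3 : ℝ) ≤ n := by exact_mod_cast hn
  set a := ((n : ℝ) - 2) / n with ha
  have ha0 : 0 < a := div_pos (by linarith) (by linarith)
  have hinv : (n : ℝ) / ((n : ℝ) - 2) = 1 / a := by rw [ha, one_div_div]
  rw [hinv] at hq2 ⊢
  have hq0 : 0 < q := by linarith
  set G := Real.Gamma (1 / a - q) * Real.Gamma (q + 1) / Real.Gamma (1 / a) with hG
  have hG0 : 0 ≤ G := by
    have h1 := Real.Gamma_pos_of_pos (sub_pos.2 hq2)
    have h2 := Real.Gamma_pos_of_pos (by linarith : 0 < q + 1)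
    have h3 := Real.Gamma_pos_of_pos (hq0.trans hq2)
    positivity
  set K := cConst n * (omegaS n / n) ^ a with hK
  have hiso : 0 < isoperimetricConst n :=
    mul_pos (by linarith) (Real.rpow_pos_of_pos (unitBallVol_pos n) _)
  have hKc : a * isoperimetricConst n ^ 2 * K = 1 := mul_isoperimetricConst_sq_mul_cConst hn
  have hai : 0 < a * isoperimetricConst n ^ 2 := by positivity
  have hK0 : 0 < K := pos_of_mul_pos_right (hKc ▸ one_pos) hai.le
  have hΩ : volume Ω ≠ ∞ := hΩb.measure_lt_top.ne
  set M := L1norm n Ω f with hM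
  have hM0 : 0 ≤ M := integral_nonneg fun _ => abs_nonneg _
  set w := (volume Ω).toReal with hw
  have hexp : 0 < 1 / q - a := by
    rw [lt_div_iff₀ ha0] at hq2
    rw [sub_pos, lt_div_iff₀ hq0]
    linarith
  have main : ∀ ε : ℝ, 0 < ε → (∫ x in Ω, |u x| ^ q) ^ (1 / q) ≤
      (2 : ℝ) ^ (a - 1) * K * G ^ (1 / q) * (w + ε) ^ (1 / q - a) * (M + ε) := by
    intro ε hε
    have hw0 : 0 < w + ε := add_pos_of_nonneg_of_pos ENNReal.toReal_nonneg hε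
    have h := hu.integral_abs_rpow_le hn hΩ (m := (M + ε) / 2) (W := w + ε) ha (by linarith)
      (by linarith) rfl (by linarith) hq0 hq2
    have hA : (a * (isoperimetricConst n ^ 2 / ((M + ε) / 2))) ^ (-q) =
        (K * ((M + ε) / 2)) ^ q := by
      have e : a * (isoperimetricConst n ^ 2 / ((M + ε) / 2)) = (K * ((M + ε) / 2))⁻¹ := by
        have : 0 < M + ε := by linarith
        field_simp
        linarith
      have hp : 0 ≤ K * ((M + ε) / 2) := mul_nonneg hK0.le (by linarith)
      rw [e, Real.rpow_neg (inv_nonneg.2 hp), Real.inv_rpow hp, inv_inv]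
    rw [← hG, hA] at h
    have hp : 0 < K * ((M + ε) / 2) := mul_pos hK0 (by linarith)
    have h2 := Real.rpow_le_rpow (integral_nonneg fun x => by positivity) h
      (one_div_nonneg.2 hq0.le)
    refine h2.trans (le_of_eq ?_)
    rw [Real.mul_rpow (by positivity) hG0, Real.mul_rpow (Real.rpow_nonneg hp.le _) (by positivity),
      Real.mul_rpow (Real.rpow_nonneg two_pos.le _) (Real.rpow_nonneg hw0.le _),
      ← Real.rpow_mul hp.le, ← Real.rpow_mul two_pos.le, ← Real.rpow_mul hw0.le]
    have e1 : q * (1 / q) = 1 := by field_simp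
    have e2 : a * q * (1 / q) = a := by field_simp
    have e3 : (1 - a * q) * (1 / q) = 1 / q - a := by field_simp
    rw [e1, e2, e3, Real.rpow_one, Real.rpow_sub_one two_ne_zero]
    ring
  have lim : Tendsto (fun ε : ℝ => (2 : ℝ) ^ (a - 1) * K * G ^ (1 / q) * (w + ε) ^ (1 / q - a) *
      (M + ε)) (𝓝[>] 0)
      (𝓝 ((2 : ℝ) ^ (a - 1) * K * G ^ (1 / q) * (w + 0) ^ (1 / q - a) * (M + 0))) := by
    have : Continuous fun ε : ℝ => (2 : ℝ) ^ (a - 1) * K * G ^ (1 / q) * (w + ε) ^ (1 / q - a) *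
        (M + ε) := by
      have := (continuous_const.add continuous_id : Continuous fun ε : ℝ => w + ε).rpow_const
        (p := 1 / q - a) fun _ => Or.inr hexp.le
      fun_prop
    exact (this.tendsto 0).mono_left nhdsWithin_le_nhds
  rw [add_zero, add_zero] at lim
  have hfin := ge_of_tendsto lim (by
    filter_upwards [self_mem_nhdsWithin] with ε hε
    exact main ε hε)
  refine hfin.trans ?_
  have h2 : (2 : ℝ) ^ (a - 1) ≤ 2 ^ (-(2 / (q * (n : ℝ)))) := by
    refine Real.rpow_le_rpow_of_exponent_le one_le_two ?_
    have e : a - 1 = -(2 / (n : ℝ)) := by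
      rw [ha]
      field_simp
      ring
    rw [e, neg_le_neg_iff]
    refine div_le_div_of_nonneg_left two_pos.le (by linarith) ?_
    nlinarith
  rw [mul_assoc (2 ^ _ : ℝ) (cConst n), ← hK]
  gcongr
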